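/- arXiv:2309.10462 — 3 statements merged into one kernel-verified Lean document; each statement's English description precedes it below -/
import Mathlib

section
/- For all integers r, m with 0 ≤ r ≤ m, the weight enumerator of the Reed–Muller code R(r+2, m+2) equals the sum, over all p in H^{(r+2)}(m+1), of the square of the weight enumerator of the coset p + R(r+1, m+1); that is, W[z; R(r+2,m+2)] = ∑_{p ∈ H^{(r+2)}(m+1)} (W[z; p + R(r+1,m+1)])². -/
open Finset Polynomial

/-- A Boolean function in `m` variables. -/
abbrev BF (m : ℕ) := (Fin m → ZMod 2) → ZMod 2

/-- The coefficient of the monomial `∏_{i ∈ S} x i` in the algebraic normal form of `f`: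
by Möbius inversion over `𝔽₂`, it equals the sum of `f x` over all inputs `x`
whose support is contained in `S`. -/
def anf {m : ℕ} (f : BF m) (S : Finset (Fin m)) : ZMod 2 :=
  ∑ x ∈ Finset.univ.filter (fun x : Fin m → ZMod 2 => ∀ i, x i = 1 → i ∈ S), f x

/-- The Reed–Muller code `R(r,m)`: Boolean functions in `m` variables of
algebraic degree at most `r`. -/
def RM (r m : ℕ) : Finset (BF m) :=
  Finset.univ.filter (fun f => ∀ S : Finset (Fin m), r < S.card → anf f S = 0)

/-- `H^{(r)}(m)`: Boolean functions in `m` variables whose algebraic normal form is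
homogeneous of degree `r`, together with the zero function. -/
def Hom (r m : ℕ) : Finset (BF m) :=
  Finset.univ.filter (fun f => ∀ S : Finset (Fin m), anf f S ≠ 0 → S.card = r)

/-- The Hamming weight of a Boolean function. -/
def wt {m : ℕ} (f : BF m) : ℕ := (Finset.univ.filter (fun x => f x = 1)).card

/-- The coset `p + C`. -/
def coset {m : ℕ} (p : BF m) (C : Finset (BF m)) : Finset (BF m) :=
  C.image (fun g => p + g)

/-- The weight enumerator `W[z; C] = ∑_{f ∈ C} z^{wt f}` of a finite set `C` of
Boolean functions. -/
noncomputable def WE {m : ℕ} (C : Finset (BF m)) : Polynomial ℕ :=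
  ∑ f ∈ C, X ^ wt f

theorem anf_add {m : ℕ} (f g : BF m) (S : Finset (Fin m)) :
    anf (f + g) S = anf f S + anf g S := by
  simp [anf, Finset.sum_add_distrib]

/-- A Boolean function is determined by its algebraic normal form. -/
theorem anf_injective (m : ℕ) :
    Function.Injective (anf : BF m → Finset (Fin m) → ZMod 2) := by
  classical
  intro f g hfg
  suffices h : ∀ S : Finset (Fin m), ∀ x : Fin m → ZMod 2,
      univ.filter (fun i => x i = 1) = S → f x = g x from funext fun x => h _ x rfl
  intro S
  induction S using Finset.strongInduction with
  | H S ih =>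
    intro x hx
    have hS := congrFun hfg S
    have hmem : x ∈ univ.filter (fun y : Fin m → ZMod 2 => ∀ i, y i = 1 → i ∈ S) := by
      simp [← hx]
    rw [anf, anf, ← Finset.add_sum_erase _ _ hmem, ← Finset.add_sum_erase _ _ hmem] at hS
    rw [Finset.sum_congr rfl (g := g)] at hS
    · exact add_right_cancel hS
    intro y hy
    simp only [mem_erase, mem_filter, mem_univ, true_and] at hy
    refine ih _ ?_ y rfl
    refine Finset.ssubset_iff_subset_ne.2 ⟨fun i hi => hy.2 i (by simpa using hi), fun h => hy.1 ?_⟩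
    funext i
    have hi := Finset.ext_iff.1 (h.trans hx.symm) i
    simp only [mem_filter, mem_univ, true_and] at hi
    generalize x i = a at hi
    generalize y i = b at hi
    revert a b
    decide

/-- Every family of coefficients is the algebraic normal form of a Boolean function. -/
theorem anf_surjective (m : ℕ) :
    Function.Surjective (anf : BF m → Finset (Fin m) → ZMod 2) :=
  ((Fintype.bijective_iff_injective_and_card _).2 ⟨anf_injective m, by simp⟩).2

theorem mem_coset_RM {r m : ℕ} {p f : BF m} :
    f ∈ coset p (RM r m) ↔ ∀ S : Finset (Fin m), r < S.card → anf f S = anf p S := by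
  simp only [coset, RM, mem_image, mem_filter, mem_univ, true_and]
  constructor
  · rintro ⟨g, hg, rfl⟩ S hS
    rw [anf_add, hg S hS, add_zero]
  · intro h
    refine ⟨p + f, fun S hS => ?_, ?_⟩
    · rw [anf_add, h S hS, CharTwo.add_self_eq_zero]
    · rw [← add_assoc, CharTwo.add_self_eq_zero, zero_add]

theorem sum_cons_zmod_two {M : Type*} [AddCommMonoid M] {m : ℕ}
    (F : (Fin (m + 1) → ZMod 2) → M) :
    ∑ x, F x = ∑ y, F (Fin.cons 0 y) + ∑ y, F (Fin.cons 1 y) := by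
  rw [← (Fin.consEquiv fun _ => ZMod 2).sum_comp, Fintype.sum_prod_type]
  exact Fin.sum_univ_two _

/-- The Boolean function in `m + 1` variables whose restrictions to `x 0 = 0` and `x 0 = 1`
are `f` and `g`. -/
def glue {m : ℕ} (f g : BF m) : BF (m + 1) :=
  fun x => if x 0 = 0 then f (Fin.tail x) else g (Fin.tail x)

theorem glue_cons_zero {m : ℕ} (f g : BF m) (y : Fin m → ZMod 2) :
    glue f g (Fin.cons 0 y) = f y := by
  simp [glue]

theorem glue_cons_one {m : ℕ} (f g : BF m) (y : Fin m → ZMod 2) :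
    glue f g (Fin.cons 1 y) = g y := by
  simp [glue]

theorem glue_injective {m : ℕ} {f g f' g' : BF m} (h : glue f g = glue f' g') :
    f = f' ∧ g = g' := by
  constructor <;> funext y
  · simpa only [glue_cons_zero] using congrFun h (Fin.cons 0 y)
  · simpa only [glue_cons_one] using congrFun h (Fin.cons 1 y)

theorem exists_eq_glue {m : ℕ} (f : BF (m + 1)) : ∃ f₀ f₁ : BF m, glue f₀ f₁ = f := by
  refine ⟨fun y => f (Fin.cons 0 y), fun y => f (Fin.cons 1 y), ?_⟩
  funext x
  obtain ⟨a, y, rfl⟩ : ∃ a y, x = Fin.cons a y := ⟨x 0, Fin.tail x, (Fin.cons_self_tail x).symm⟩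
  obtain rfl | rfl : a = 0 ∨ a = 1 := by
    revert a
    decide
  · rw [glue_cons_zero]
  · rw [glue_cons_one]

theorem wt_glue {m : ℕ} (f g : BF m) : wt (glue f g) = wt f + wt g := by
  simp only [wt, Finset.card_filter, sum_cons_zmod_two, glue_cons_zero, glue_cons_one]

theorem anf_glue_map {m : ℕ} (f g : BF m) (S : Finset (Fin m)) :
    anf (glue f g) (S.map (Fin.succEmb m)) = anf f S := by
  simp [anf, Finset.sum_filter, sum_cons_zmod_two, glue_cons_zero, Fin.forall_fin_succ]

theorem anf_glue_insert {m : ℕ} (f g : BF m) (S : Finset (Fin m)) :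
    anf (glue f g) (insert 0 (S.map (Fin.succEmb m))) = anf f S + anf g S := by
  simp [anf, Finset.sum_filter, sum_cons_zmod_two, glue_cons_zero, glue_cons_one,
    Fin.forall_fin_succ]

theorem exists_eq_map_succ_or_insert {m : ℕ} (T : Finset (Fin (m + 1))) :
    ∃ S : Finset (Fin m),
      T = S.map (Fin.succEmb m) ∨ T = insert 0 (S.map (Fin.succEmb m)) := by
  refine ⟨univ.filter fun i => i.succ ∈ T, ?_⟩
  by_cases h : (0 : Fin (m + 1)) ∈ T
  · right
    ext i
    cases i using Fin.cases <;> simp [h]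
  · left
    ext i
    cases i using Fin.cases <;> simp [h]

/-- The `(u | u + v)` description of the Reed–Muller codes. -/
theorem glue_mem_RM {r m : ℕ} {f g : BF m} :
    glue f g ∈ RM (r + 1) (m + 1) ↔
      (∀ S : Finset (Fin m), r + 1 < S.card → anf f S = 0) ∧
        ∀ S : Finset (Fin m), r < S.card → anf f S = anf g S := by
  have hcard (S : Finset (Fin m)) :
      (insert 0 (S.map (Fin.succEmb m))).card = S.card + 1 := by
    rw [Finset.card_insert_of_notMem (by simp), Finset.card_map]
  simp only [RM, mem_filter, mem_univ, true_and]
  constructor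
  · intro h
    refine ⟨fun S hS => ?_, fun S hS => ?_⟩
    · rw [← anf_glue_map f g]
      exact h _ (by simpa using hS)
    · rw [← CharTwo.add_eq_zero, ← anf_glue_insert]
      exact h _ (by rw [hcard]; omega)
  · rintro ⟨h₁, h₂⟩ T hT
    obtain ⟨S, rfl | rfl⟩ := exists_eq_map_succ_or_insert T
    · rw [anf_glue_map]
      exact h₁ S (by simpa using hT)
    · rw [anf_glue_insert, CharTwo.add_eq_zero]
      exact h₂ S (by rw [hcard] at hT; omega)

/-- Theorem 1 (Sarwate): the weight enumerator of `R(r+2, m+2)` is the sum over all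
`p ∈ H^{(r+2)}(m+1)` of the square of the weight enumerator of `p + R(r+1, m+1)`. -/
theorem statement0 (r m : ℕ) (hrm : r ≤ m) :
    WE (RM (r + 2) (m + 2)) =
      ∑ p ∈ Hom (r + 2) (m + 1), (WE (coset p (RM (r + 1) (m + 1)))) ^ 2 := by
  classical
  simp only [WE, sq, Finset.sum_mul_sum, ← Finset.sum_product', ← pow_add]
  rw [Finset.sum_sigma']
  symm
  refine Finset.sum_bij (fun x _ => glue x.2.1 x.2.2) ?_ ?_ ?_ ?_
  · rintro ⟨p, f, g⟩ h
    simp only [mem_sigma, mem_product, mem_coset_RM, Hom, mem_filter, mem_univ, true_and] at h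
    obtain ⟨hp, hf, hg⟩ := h
    refine glue_mem_RM.2 ⟨fun S hS => ?_, fun S hS => (hf S hS).trans (hg S hS).symm⟩
    rw [hf S (by omega)]
    by_contra hne
    have := hp S hne
    omega
  · rintro ⟨p, f, g⟩ h ⟨p', f', g'⟩ h' heq
    obtain ⟨rfl, rfl⟩ := glue_injective heq
    simp only [mem_sigma, mem_product, mem_coset_RM, Hom, mem_filter, mem_univ, true_and] at h h'
    obtain rfl : p = p' := by
      refine anf_injective _ (funext fun S => ?_)
      by_cases hS : S.card = r + 2
      · rw [← h.2.1 S (by omega), ← h'.2.1 S (by omega)]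
      · rw [not_not.1 (mt (h.1 S) hS), not_not.1 (mt (h'.1 S) hS)]
    rfl
  · intro F hF
    obtain ⟨f, g, rfl⟩ := exists_eq_glue F
    obtain ⟨h₁, h₂⟩ := glue_mem_RM.1 hF
    obtain ⟨p, hp⟩ := anf_surjective _ fun S : Finset (Fin (m + 1)) =>
      if S.card = r + 2 then anf f S else 0
    have hfp : ∀ S : Finset (Fin (m + 1)), r + 1 < S.card → anf f S = anf p S := by
      intro S hS
      simp only [hp]
      split_ifs with hc
      · rfl
      · exact h₁ S (by omega)
    refine ⟨⟨p, f, g⟩, ?_, rfl⟩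
    simp only [mem_sigma, mem_product, mem_coset_RM, Hom, mem_filter, mem_univ, true_and]
    refine ⟨fun S hS => ?_, hfp, fun S hS => (h₂ S hS).symm.trans (hfp S hS)⟩
    by_contra hc
    exact hS (by simp only [hp, if_neg hc])
  · rintro ⟨p, f, g⟩ _
    rw [wt_glue]
end

section
/- Let e ∈ H^{(r+2)}(m), let A be an invertible affine transformation of (ZMod 2)^m belonging to the stabilizer of e, i.e. satisfying e ∘ A + e ∈ R(r+1,m), and let g ∈ H^{(r+1)}(m). Then there exists g' ∈ H^{(r+1)}(m) such that (e+g) ∘ A ∈ e + g' + R(r,m), and moreover W[z; e+g+R(r,m)] = W[z; e+g'+R(r,m)]. -/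
open Finset Polynomial

namespace BF

variable {m : ℕ}

/-- The monomial `∏_{i ∈ S} x i`. -/
def mono (S : Finset (Fin m)) : BF m := fun x => ∏ i ∈ S, x i

/-- The support of a vector. -/
def supp (x : Fin m → ZMod 2) : Finset (Fin m) := Finset.univ.filter (fun i => x i = 1)

theorem supp_injective : Function.Injective (supp (m := m)) := by
  intro x y h
  funext i
  have hi : x i = 1 ↔ y i = 1 := by simpa [supp] using congrArg (i ∈ ·) h
  have key : ∀ a b : ZMod 2, (a = 1 ↔ b = 1) → a = b := by decide
  exact key _ _ hi

theorem mono_apply (S : Finset (Fin m)) (x : Fin m → ZMod 2) :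
    mono S x = if S ⊆ supp x then 1 else 0 := by
  have key : ∀ a : ZMod 2, a ≠ 1 → a = 0 := by decide
  unfold mono
  split_ifs with h
  · exact Finset.prod_eq_one fun i hi => by simpa [supp] using h hi
  · obtain ⟨i, hi, hx⟩ := Finset.not_subset.mp h
    exact Finset.prod_eq_zero hi (key _ (by simpa [supp] using hx))

theorem anf_eq_sum_ite (f : BF m) (S : Finset (Fin m)) :
    anf f S = ∑ x, if supp x ⊆ S then f x else 0 := by
  unfold anf
  rw [Finset.sum_filter]
  refine Finset.sum_congr rfl fun x _ => ?_
  simp [supp, Finset.subset_iff]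

theorem card_Icc_cast (U T : Finset (Fin m)) :
    ((Finset.Icc U T).card : ZMod 2) = if U = T then 1 else 0 := by
  by_cases h : U ⊆ T
  · rw [Finset.card_Icc_finset h]
    split_ifs with hUT
    · simp [hUT]
    · have := Finset.card_lt_card (Finset.ssubset_iff_subset_ne.mpr ⟨h, hUT⟩)
      have h2 : (2 : ZMod 2) = 0 := by decide
      push_cast
      rw [h2, zero_pow (by omega)]
  · rw [if_neg (fun hUT => h hUT.subset), Finset.Icc_eq_empty h]
    simp

/-- The algebraic normal form represents the function. -/
theorem sum_anf_smul_mono (f : BF m) : ∑ S, anf f S • mono S = f := by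
  funext x
  simp only [Finset.sum_apply, Pi.smul_apply, smul_eq_mul, anf_eq_sum_ite, Finset.sum_mul]
  rw [Finset.sum_comm]
  have h (y : Fin m → ZMod 2) :
      ∑ S, (if supp y ⊆ S then f y else 0) * mono S x = if y = x then f y else 0 := by
    have h1 : ∀ S : Finset (Fin m), (if supp y ⊆ S then f y else 0) * mono S x
        = if S ∈ Finset.Icc (supp y) (supp x) then f y else 0 := by
      intro S
      rw [mono_apply]
      by_cases h1 : supp y ⊆ S <;> by_cases h2 : S ⊆ supp x <;> simp [h1, h2]
    simp only [h1]
    rw [← Finset.sum_filter, Finset.filter_mem_eq_inter, Finset.univ_inter, Finset.sum_const,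
      nsmul_eq_mul, card_Icc_cast]
    simp [supp_injective.eq_iff]
  rw [Finset.sum_congr rfl fun y _ => h y]
  simp

theorem anf_bijective : Function.Bijective (anf (m := m)) := by
  rw [Fintype.bijective_iff_injective_and_card]
  refine ⟨fun f g h => ?_, by simp⟩
  rw [← sum_anf_smul_mono f, ← sum_anf_smul_mono g, h]

/-- The algebraic normal form is unique. -/
theorem anf_sum_smul_mono (c : Finset (Fin m) → ZMod 2) : anf (∑ S, c S • mono S) = c := by
  obtain ⟨f, rfl⟩ := anf_bijective.surjective c
  rw [sum_anf_smul_mono]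

theorem anf_add (f g : BF m) (S : Finset (Fin m)) : anf (f + g) S = anf f S + anf g S := by
  simp [anf, Finset.sum_add_distrib]

theorem anf_mono (S T : Finset (Fin m)) : anf (mono S) T = if T = S then 1 else 0 := by
  simpa using congrFun (anf_sum_smul_mono (fun U => if U = S then (1 : ZMod 2) else 0)) T

theorem add_mem_RM {r : ℕ} {f g : BF m} (hf : f ∈ RM r m) (hg : g ∈ RM r m) :
    f + g ∈ RM r m := by
  simp only [RM, Finset.mem_filter, Finset.mem_univ, true_and] at *
  intro S hS
  rw [anf_add, hf S hS, hg S hS, add_zero]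

/-- The span of the monomials of degree at most `r`. -/
def monoSpan (r m : ℕ) : Submodule (ZMod 2) (BF m) :=
  Submodule.span (ZMod 2) {f | ∃ S : Finset (Fin m), S.card ≤ r ∧ mono S = f}

theorem mono_mem_monoSpan {r : ℕ} {S : Finset (Fin m)} (h : S.card ≤ r) :
    mono S ∈ monoSpan r m := Submodule.subset_span ⟨S, h, rfl⟩

theorem monoSpan_mono {r s : ℕ} (h : r ≤ s) : monoSpan r m ≤ monoSpan s m :=
  Submodule.span_mono fun _ ⟨S, hS, hf⟩ => ⟨S, hS.trans h, hf⟩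

theorem mem_RM_iff_mem_monoSpan {r : ℕ} {f : BF m} : f ∈ RM r m ↔ f ∈ monoSpan r m := by
  constructor
  · intro h
    simp only [RM, Finset.mem_filter, Finset.mem_univ, true_and] at h
    rw [← sum_anf_smul_mono f]
    refine Submodule.sum_mem _ fun S _ => ?_
    by_cases hS : S.card ≤ r
    · exact Submodule.smul_mem _ _ (mono_mem_monoSpan hS)
    · rw [h S (by omega), zero_smul]
      exact Submodule.zero_mem _
  · intro h
    induction h using Submodule.span_induction with
    | mem f hf =>
      obtain ⟨S, hS, rfl⟩ := hf
      simp only [RM, Finset.mem_filter, Finset.mem_univ, true_and, anf_mono]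
      intro T hT
      exact if_neg (by rintro rfl; omega)
    | zero => exact Finset.mem_filter.mpr ⟨Finset.mem_univ _, fun S _ => by simp [anf]⟩
    | add f g _ _ hf hg => exact add_mem_RM hf hg
    | smul c f _ hf =>
      simp only [RM, Finset.mem_filter, Finset.mem_univ, true_and] at *
      intro S hS
      have : anf (c • f) S = c * anf f S := by simp [anf, Finset.mul_sum]
      rw [this, hf S hS, mul_zero]

theorem coord_mul_mem_monoSpan {r : ℕ} {f : BF m} (hf : f ∈ monoSpan r m) (i : Fin m) :
    (fun x => x i * f x) ∈ monoSpan (r + 1) m := by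
  let φ : BF m →ₗ[ZMod 2] BF m := LinearMap.mulLeft (ZMod 2) (fun x => x i)
  suffices h : monoSpan r m ≤ (monoSpan (r + 1) m).comap φ from h hf
  refine Submodule.span_le.mpr ?_
  rintro _ ⟨S, hS, rfl⟩
  have : φ (mono S) = mono (insert i S) := by
    funext x
    have key : ∀ a : ZMod 2, a * a = a := by decide
    by_cases hi : i ∈ S
    · rw [Finset.insert_eq_of_mem hi]
      simp only [φ, LinearMap.mulLeft_apply, Pi.mul_apply, mono]
      rw [← Finset.mul_prod_erase S _ hi, ← mul_assoc, key]
    · simp [φ, mono, Finset.prod_insert hi]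
  rw [SetLike.mem_coe, Submodule.mem_comap, this]
  exact mono_mem_monoSpan ((Finset.card_insert_le _ _).trans (by omega))

theorem affine_mul_mem_monoSpan {r : ℕ} {f : BF m} (hf : f ∈ monoSpan r m)
    (ℓ : (Fin m → ZMod 2) →ₗ[ZMod 2] ZMod 2) (c : ZMod 2) :
    (fun x => (ℓ x + c) * f x) ∈ monoSpan (r + 1) m := by
  have : (fun x => (ℓ x + c) * f x)
      = ∑ i, ℓ (Pi.single i 1) • (fun x : Fin m → ZMod 2 => x i * f x) + c • f := by
    funext x
    have hx : ℓ x = ∑ i, x i * ℓ (Pi.single i 1) := by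
      rw [LinearMap.pi_apply_eq_sum_univ ℓ x]
      refine Finset.sum_congr rfl fun i _ => ?_
      rw [smul_eq_mul]
      congr 2
      funext j
      simp [Pi.single_apply, eq_comm]
    simp only [hx, Pi.add_apply, Finset.sum_apply, Pi.smul_apply, smul_eq_mul, add_mul,
      Finset.sum_mul]
    congr 1
    exact Finset.sum_congr rfl fun i _ => by ring
  rw [this]
  exact Submodule.add_mem _
    (Submodule.sum_mem _ fun i _ => Submodule.smul_mem _ _ (coord_mul_mem_monoSpan hf i))
    (Submodule.smul_mem _ _ (monoSpan_mono (Nat.le_succ r) hf))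

/-- Affine substitutions do not increase the degree. -/
theorem comp_affine_mem_RM {r : ℕ} {f : BF m} (hf : f ∈ RM r m)
    (L : (Fin m → ZMod 2) →ₗ[ZMod 2] (Fin m → ZMod 2)) (b : Fin m → ZMod 2) :
    (fun x => f (L x + b)) ∈ RM r m := by
  rw [mem_RM_iff_mem_monoSpan] at *
  let φ : BF m →ₗ[ZMod 2] BF m := LinearMap.funLeft (ZMod 2) (ZMod 2) (fun x => L x + b)
  suffices h : monoSpan r m ≤ (monoSpan r m).comap φ from h hf
  refine Submodule.span_le.mpr ?_
  rintro _ ⟨S, hS, rfl⟩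
  refine monoSpan_mono hS ?_
  clear hS
  induction S using Finset.induction_on with
  | empty => exact mono_mem_monoSpan (S := ∅) le_rfl
  | insert i S hi ih =>
    have : φ (mono (insert i S))
        = fun x => ((LinearMap.proj i ∘ₗ L) x + b i) * φ (mono S) x := by
      funext x
      simp [φ, mono, LinearMap.funLeft_apply, Finset.prod_insert hi]
    rw [this, Finset.card_insert_of_notMem hi]
    exact affine_mul_mem_monoSpan ih _ _

theorem mem_RM_of_mem_Hom {r : ℕ} {f : BF m} (hf : f ∈ Hom r m) : f ∈ RM r m := by
  simp only [Hom, RM, Finset.mem_filter, Finset.mem_univ, true_and] at *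
  intro S hS
  by_contra h
  exact hS.ne' (hf S h)

/-- A function of degree at most `r + 1` agrees with its homogeneous part of degree `r + 1`
up to a function of degree at most `r`. -/
theorem exists_mem_Hom_add_mem_RM {r : ℕ} {f : BF m} (hf : f ∈ RM (r + 1) m) :
    ∃ g ∈ Hom (r + 1) m, g + f ∈ RM r m := by
  simp only [Hom, RM, Finset.mem_filter, Finset.mem_univ, true_and] at *
  refine ⟨∑ S, (if S.card = r + 1 then anf f S else 0) • mono S, fun S => ?_, fun S hS => ?_⟩
  · rw [anf_sum_smul_mono (fun S => if S.card = r + 1 then anf f S else 0)]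
    intro h
    by_contra hS
    exact h (if_neg hS)
  · rw [anf_add, anf_sum_smul_mono (fun S => if S.card = r + 1 then anf f S else 0)]
    by_cases h : S.card = r + 1
    · simp only [if_pos h]
      exact CharTwo.add_self_eq_zero _
    · simp only [if_neg h]
      rw [hf S (by omega), add_zero]

theorem mem_coset_iff {p f : BF m} {C : Finset (BF m)} : f ∈ coset p C ↔ p + f ∈ C := by
  have h (p f : BF m) : p + (p + f) = f := by
    rw [← add_assoc, CharTwo.add_self_eq_zero, zero_add]
  unfold coset
  rw [Finset.mem_image]
  constructor
  · rintro ⟨g, hg, rfl⟩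
    rwa [h]
  · exact fun hf => ⟨_, hf, h p f⟩

theorem wt_comp_equiv (f : BF m) (A : (Fin m → ZMod 2) ≃ (Fin m → ZMod 2)) :
    wt (fun x => f (A x)) = wt f :=
  Finset.card_equiv A (by simp)

/-- Cosets of a Reed–Muller code with affinely equivalent representatives have the same weight
enumerator. -/
theorem WE_coset_eq_of_comp_mem {r : ℕ} {p q : BF m}
    (L : (Fin m → ZMod 2) ≃ₗ[ZMod 2] (Fin m → ZMod 2)) (b : Fin m → ZMod 2)
    (h : (fun x => p (L x + b)) ∈ coset q (RM r m)) :
    WE (coset p (RM r m)) = WE (coset q (RM r m)) := by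
  let A : (Fin m → ZMod 2) ≃ (Fin m → ZMod 2) := L.toEquiv.trans (Equiv.addRight b)
  have hinv (x : Fin m → ZMod 2) : A.symm x = L.symm x + L.symm (-b) := by
    rw [Equiv.symm_apply_eq]
    simp [A]
  have hback {f : BF m} (hf : (fun x => f (A x)) ∈ RM r m) : f ∈ RM r m := by
    have h1 := comp_affine_mem_RM hf L.symm (L.symm (-b))
    have h2 : (fun x => f (A (L.symm x + L.symm (-b)))) = f := by
      funext x
      rw [← hinv, Equiv.apply_symm_apply]
    rwa [← h2]
  have hsum (f : BF m) : q + (fun x => f (A x))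
      = (q + fun x => p (A x)) + fun x => (p + f) (A x) := by
    funext x
    have : p (A x) + p (A x) = 0 := CharTwo.add_self_eq_zero _
    simp only [Pi.add_apply]
    linear_combination -this
  have hsum' (f : BF m) : (fun x => (p + f) (A x))
      = (q + fun x => p (A x)) + (q + fun x => f (A x)) := by
    rw [hsum f, ← add_assoc, CharTwo.add_self_eq_zero, zero_add]
  have hq : (q + fun x => p (A x)) ∈ RM r m := mem_coset_iff.mp h
  unfold WE
  refine Finset.sum_equiv (Equiv.arrowCongr A.symm (Equiv.refl _)) (fun f => ?_) fun f _ => ?_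
  · rw [mem_coset_iff, mem_coset_iff]
    change p + f ∈ RM r m ↔ (q + fun x => f (A x)) ∈ RM r m
    constructor
    · intro hf
      rw [hsum]
      exact add_mem_RM hq (comp_affine_mem_RM hf L.toLinearMap b)
    · intro hf
      apply hback
      rw [hsum']
      exact add_mem_RM hq hf
  · exact congrArg (X ^ ·) (wt_comp_equiv f A).symm

end BF

/-- If `A : x ↦ Lx + b` stabilizes `e ∈ H^{(r+2)}(m)` modulo `R(r+1,m)` and
`g ∈ H^{(r+1)}(m)`, then `(e+g) ∘ A` lies in a coset `e + g' + R(r,m)` with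
`g' ∈ H^{(r+1)}(m)`, and the two cosets have the same weight enumerator. -/
theorem statement5 (r m : ℕ) (e : BF m) (he : e ∈ Hom (r + 2) m)
    (L : (Fin m → ZMod 2) ≃ₗ[ZMod 2] (Fin m → ZMod 2)) (b : Fin m → ZMod 2)
    (hA : ((fun x => e (L x + b)) + e) ∈ RM (r + 1) m)
    (g : BF m) (hg : g ∈ Hom (r + 1) m) :
    ∃ g' ∈ Hom (r + 1) m,
      (fun x => (e + g) (L x + b)) ∈ coset (e + g') (RM r m) ∧
      WE (coset (e + g) (RM r m)) = WE (coset (e + g') (RM r m)) := by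
  obtain ⟨g', hg', h⟩ := BF.exists_mem_Hom_add_mem_RM (BF.add_mem_RM hA
    (BF.comp_affine_mem_RM (BF.mem_RM_of_mem_Hom hg) L.toLinearMap b))
  have hmem : (fun x => (e + g) (L x + b)) ∈ coset (e + g') (RM r m) := by
    rw [BF.mem_coset_iff]
    convert h using 1
    funext x
    simp only [Pi.add_apply, LinearEquiv.coe_coe]
    ring
  exact ⟨g', hg', hmem, BF.WE_coset_eq_of_comp_mem L b hmem⟩
end

section
/- In the Reed–Muller code R(4,9), there is no codeword of Hamming weight strictly between 32 and 48, and the number of codewords of Hamming weight exactly 48 is 919315326720. -/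
open Finset Polynomial

section Flats

variable {V : Type*} [AddCommGroup V]

/-- A flat of an `𝔽₂`-vector space: a nonempty finite set closed under sums of three points. -/
def IsFlat (A : Finset V) : Prop :=
  A.Nonempty ∧ ∀ x ∈ A, ∀ y ∈ A, ∀ z ∈ A, x + y + z ∈ A

/-- The translate of a finite set by `v`. -/
def shift (v : V) (A : Finset V) : Finset V :=
  A.map (addRightEmbedding v)

@[simp]
theorem card_shift (v : V) (A : Finset V) : (shift v A).card = A.card :=
  card_map _

theorem shift_subset_shift {v : V} {A B : Finset V} (h : A ⊆ B) : shift v A ⊆ shift v B :=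
  map_subset_map.2 h

theorem IsFlat.mem_of_eq {A : Finset V} (hA : IsFlat A) {x y z w : V} (hx : x ∈ A) (hy : y ∈ A)
    (hz : z ∈ A) (hw : x + y + z = w) : w ∈ A :=
  hw ▸ hA.2 x hx y hy z hz

theorem IsFlat.inter [DecidableEq V] {A B : Finset V} (hA : IsFlat A) (hB : IsFlat B)
    (h : (A ∩ B).Nonempty) :
    IsFlat (A ∩ B) := by
  refine ⟨h, fun x hx y hy z hz => ?_⟩
  rw [mem_inter] at *
  exact ⟨hA.2 x hx.1 y hy.1 z hz.1, hB.2 x hx.2 y hy.2 z hz.2⟩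

variable [Module (ZMod 2) V]

theorem add_add_self_left (x y : V) : x + (x + y) = y := by
  rw [← add_assoc, ZModModule.add_self, zero_add]

@[simp]
theorem mem_shift {v x : V} {A : Finset V} : x ∈ shift v A ↔ x + v ∈ A := by
  simp only [shift, mem_map, addRightEmbedding_apply]
  constructor
  · rintro ⟨a, ha, rfl⟩
    rwa [add_assoc, ZModModule.add_self, add_zero]
  · intro h
    exact ⟨x + v, h, by rw [add_assoc, ZModModule.add_self, add_zero]⟩

theorem IsFlat.shifted {A : Finset V} (hA : IsFlat A) (v : V) : IsFlat (shift v A) := by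
  refine ⟨by simpa [← card_pos] using hA.1, fun x hx y hy z hz => ?_⟩
  rw [mem_shift] at *
  refine hA.mem_of_eq hx hy hz ?_
  simp only [add_comm, add_left_comm, add_add_self_left]

/-- If a translation by `t` does not preserve a flat, it moves it off itself. -/
theorem IsFlat.add_mem_iff {A : Finset V} (hA : IsFlat A) {x y t : V} (hx : x ∈ A) (hy : y ∈ A) :
    x + t ∈ A ↔ y + t ∈ A := by
  constructor <;> intro h
  · refine hA.mem_of_eq hx hy h ?_
    simp only [add_comm, add_left_comm, add_add_self_left]
  · refine hA.mem_of_eq hx hy h ?_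
    simp only [add_comm, add_left_comm, add_add_self_left]

theorem IsFlat.disjoint_shift {A : Finset V} (hA : IsFlat A) {x t : V} (hx : x ∈ A)
    (ht : x + t ∉ A) : Disjoint A (shift t A) := by
  rw [disjoint_left]
  intro y hy hyt
  exact ht ((hA.add_mem_iff hx hy).2 (mem_shift.1 hyt))

variable [DecidableEq V]

theorem IsFlat.union_shift {A : Finset V} (hA : IsFlat A) (t : V) :
    IsFlat (A ∪ shift t A) := by
  refine ⟨hA.1.mono subset_union_left, fun x hx y hy z hz => ?_⟩
  simp only [mem_union, mem_shift] at *
  rcases hx with hx | hx <;> rcases hy with hy | hy <;> rcases hz with hz | hz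
  all_goals
    first
    | (refine Or.inl (hA.mem_of_eq hx hy hz ?_)
       simp only [add_comm, add_left_comm, add_add_self_left]
       done)
    | (refine Or.inr (hA.mem_of_eq hx hy hz ?_)
       simp only [add_comm, add_left_comm, add_add_self_left])

theorem IsFlat.card_union_shift {A : Finset V} (hA : IsFlat A) {x t : V} (hx : x ∈ A)
    (ht : x + t ∉ A) : (A ∪ shift t A).card = 2 * A.card := by
  rw [card_union_of_disjoint (hA.disjoint_shift hx ht), card_shift, two_mul]

theorem IsFlat.union_shift_subset {P Q : Finset V} (hQ : IsFlat Q) (hPQ : P ⊆ Q) {x y : V}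
    (hx : x ∈ Q) (hy : y ∈ Q) : P ∪ shift (x + y) P ⊆ Q := by
  refine union_subset hPQ fun z hz => ?_
  refine hQ.mem_of_eq hx hy (hPQ (mem_shift.1 hz)) ?_
  simp only [add_comm, add_left_comm, add_add_self_left]

/-- A proper subflat has at most half of the points. -/
theorem IsFlat.two_mul_card_le {P Q : Finset V} (hP : IsFlat P) (hQ : IsFlat Q) (hPQ : P ⊆ Q)
    (hne : P ≠ Q) : 2 * P.card ≤ Q.card := by
  obtain ⟨p, hp⟩ := hP.1
  obtain ⟨q, hq, hqP⟩ := exists_of_ssubset (hPQ.ssubset_of_ne hne)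
  rw [← hP.card_union_shift hp (t := p + q) (by rwa [add_add_self_left])]
  exact card_le_card (hQ.union_shift_subset hPQ (hPQ hp) hq)

/-- Two points outside a half of a flat differ by a translation that preserves the half. -/
theorem IsFlat.add_mem_of_half {P Q : Finset V} (hP : IsFlat P) (hQ : IsFlat Q) (hPQ : P ⊆ Q)
    (hc : Q.card ≤ 2 * P.card) {x y z : V} (hx : x ∈ Q) (hxP : x ∉ P) (hy : y ∈ Q) (hyP : y ∉ P)
    (hz : z ∈ P) : x + y + z ∈ P := by
  have hu : P ∪ shift (z + x) P = Q := by
    refine eq_of_subset_of_card_le (hQ.union_shift_subset hPQ (hPQ hz) hx) ?_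
    rwa [hP.card_union_shift hz (by rwa [add_add_self_left])]
  rw [← hu, mem_union, mem_shift] at hy
  have h := hy.resolve_left hyP
  rwa [show x + y + z = y + (z + x) by simp only [add_comm, add_left_comm]]

/-- Sliding the complement of a half of a flat along `v` yields a flat. -/
theorem IsFlat.union_shift_sdiff {P Q : Finset V} (hP : IsFlat P) (hQ : IsFlat Q)
    (hPQ : P ⊆ Q) (hc : Q.card ≤ 2 * P.card) (v : V) :
    IsFlat (P ∪ shift v (Q \ P)) := by
  have h2 : ∀ {x y z w : V}, x ∈ Q → x ∉ P → y ∈ Q → y ∉ P → z ∈ P → x + y + z = w → w ∈ P :=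
    fun hx hxP hy hyP hz hw => hw ▸ hP.add_mem_of_half hQ hPQ hc hx hxP hy hyP hz
  have h1 : ∀ {x y z w : V}, x ∈ Q → x ∉ P → y ∈ P → z ∈ P → x + y + z = w → w ∈ Q ∧ w ∉ P := by
    rintro x y z w hx hxP hy hz rfl
    refine ⟨hQ.2 x hx y (hPQ hy) z (hPQ hz), fun h => hxP (hP.mem_of_eq h hy hz ?_)⟩
    simp only [add_comm, add_left_comm, add_add_self_left, ZModModule.add_self, add_zero]
  have h3 : ∀ {x y z w : V}, x ∈ Q → x ∉ P → y ∈ Q → y ∉ P → z ∈ Q → z ∉ P →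
      x + y + z = w → w ∈ Q ∧ w ∉ P := by
    rintro x y z w hx hxP hy hyP hz hzP rfl
    refine ⟨hQ.2 x hx y hy z hz, fun h => hzP (h2 hx hxP hy hyP h ?_)⟩
    simp only [add_comm, add_left_comm, add_add_self_left]
  refine ⟨hP.1.mono subset_union_left, fun x hx y hy z hz => ?_⟩
  simp only [mem_union, mem_shift, mem_sdiff] at *
  rcases hx with hx | ⟨hx, hx'⟩ <;> rcases hy with hy | ⟨hy, hy'⟩ <;> rcases hz with hz | ⟨hz, hz'⟩
  · exact Or.inl (hP.2 x hx y hy z hz)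
  · refine Or.inr (h1 hz hz' hx hy ?_)
    simp only [add_comm, add_left_comm]
  · refine Or.inr (h1 hy hy' hx hz ?_)
    simp only [add_comm, add_left_comm]
  · refine Or.inl (h2 hy hy' hz hz' hx ?_)
    simp only [add_comm, add_left_comm, add_add_self_left]
  · refine Or.inr (h1 hx hx' hy hz ?_)
    simp only [add_comm, add_left_comm]
  · refine Or.inl (h2 hx hx' hz hz' hy ?_)
    simp only [add_comm, add_left_comm, add_add_self_left]
  · refine Or.inl (h2 hx hx' hy hy' hz ?_)
    simp only [add_comm, add_left_comm, add_add_self_left]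
  · refine Or.inr (h3 hx hx' hy hy' hz hz' ?_)
    simp only [add_comm, add_left_comm, add_add_self_left]

end Flats

section Pairs

variable {V : Type*} [AddCommGroup V] [DecidableEq V]

/-- `S` is the symmetric difference of two flats of `W` with `d` points each
that share `d / 4` points. -/
def IsFlatPair (d : ℕ) (W S : Finset V) : Prop :=
  ∃ B C : Finset V, IsFlat B ∧ IsFlat C ∧ B ⊆ W ∧ C ⊆ W ∧ B.card = d ∧ C.card = d ∧
    4 * (B ∩ C).card = d ∧ S = symmDiff B C

theorem card_symmDiff_add {α : Type*} [DecidableEq α] (A B : Finset α) :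
    (symmDiff A B).card + 2 * (A ∩ B).card = A.card + B.card := by
  have h1 := card_sdiff_add_card_inter A B
  have h2 := card_sdiff_add_card_inter B A
  have h3 : (symmDiff A B).card = (A \ B).card + (B \ A).card :=
    card_union_of_disjoint disjoint_sdiff_sdiff
  rw [inter_comm] at h2
  omega

theorem IsFlatPair.two_mul_card {d : ℕ} {W S : Finset V} (h : IsFlatPair d W S) :
    2 * S.card = 3 * d := by
  obtain ⟨B, C, -, -, -, -, hB, hC, hD, rfl⟩ := h
  have := card_symmDiff_add B C
  omega

theorem IsFlatPair.mono {d : ℕ} {W W' S : Finset V} (h : IsFlatPair d W S) (hW : W ⊆ W') :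
    IsFlatPair d W' S := by
  obtain ⟨B, C, hB, hC, hBW, hCW, h⟩ := h
  exact ⟨B, C, hB, hC, hBW.trans hW, hCW.trans hW, h⟩

theorem card_union_shift_symmDiff {W A G : Finset V} {v : V} (hW : Disjoint W (shift v W))
    (hA : A ⊆ W) (hG : G ⊆ W) :
    (A ∪ shift v (symmDiff A G)).card + 2 * (A ∩ G).card = 2 * A.card + G.card := by
  have h := card_symmDiff_add A G
  have hAG : symmDiff A G ⊆ W := symmDiff_subset_union.trans (union_subset hA hG)
  rw [card_union_of_disjoint (hW.mono hA (shift_subset_shift hAG)), card_shift]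
  omega

variable [Module (ZMod 2) V]

theorem IsFlatPair.shifted {d : ℕ} {W S : Finset V} (h : IsFlatPair d W S) (v : V) :
    IsFlatPair d (shift v W) (shift v S) := by
  obtain ⟨B, C, hB, hC, hBW, hCW, hBd, hCd, hD, rfl⟩ := h
  refine ⟨shift v B, shift v C, hB.shifted v, hC.shifted v, shift_subset_shift hBW,
    shift_subset_shift hCW, by simpa, by simpa, ?_, ?_⟩
  · rw [shift, shift, ← map_inter, card_map, hD]
  · ext x
    simp [mem_symmDiff]

/-- Gluing a flat `A` on one half to the sum of `A` and a flat `B` on the other half. -/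
theorem glue_flat {W A B : Finset V} {v : V} {d : ℕ} (hW : Disjoint W (shift v W))
    (hA : IsFlat A) (hB : IsFlat B) (hAW : A ⊆ W) (hBW : B ⊆ W) (hAd : 2 * A.card = d)
    (hBd : B.card = d) (hS : 2 * (A ∪ shift v (symmDiff A B)).card ≤ 3 * d) :
    (IsFlat (A ∪ shift v (symmDiff A B)) ∧ (A ∪ shift v (symmDiff A B)).card = d) ∨
      IsFlatPair d (W ∪ shift v W) (A ∪ shift v (symmDiff A B)) := by
  have hc := card_union_shift_symmDiff hW hAW hBW
  have hApos := hA.1.card_pos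
  by_cases hAB : A ⊆ B
  · left
    rw [inter_eq_left.2 hAB] at hc
    have hsd : symmDiff A B = B \ A := by
      ext x
      have := @hAB x
      simp only [mem_symmDiff, mem_sdiff]
      tauto
    refine ⟨?_, by omega⟩
    rw [hsd]
    exact hA.union_shift_sdiff hB hAB (by omega) v
  · right
    have hne : (A ∩ B).Nonempty := card_pos.1 (by omega)
    have h2 := (hA.inter hB hne).two_mul_card_le hA inter_subset_left
      (fun h => hAB (inter_eq_left.1 h))
    obtain ⟨a, ha⟩ := hA.1
    have hav : a + v ∉ A := fun h =>
      disjoint_left.1 hW (hAW ha) (mem_shift.2 (hAW h))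
    refine ⟨A ∪ shift v A, shift v B, hA.union_shift v, hB.shifted v,
      union_subset_union hAW (shift_subset_shift hAW),
      (shift_subset_shift hBW).trans subset_union_right, ?_, by simpa, ?_, ?_⟩
    · rw [hA.card_union_shift ha hav, hAd]
    · have : (A ∪ shift v A) ∩ shift v B = shift v (A ∩ B) := by
        ext x
        have := fun h h' => disjoint_left.1 hW (@hAW x h) (shift_subset_shift hBW h')
        simp only [mem_inter, mem_union, mem_shift] at *
        tauto
      rw [this, card_shift]
      omega
    · ext x
      have := fun h h' => disjoint_left.1 hW (@hAW x h) (shift_subset_shift hBW h')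
      have := fun h h' => disjoint_left.1 hW (@hAW x h) (shift_subset_shift hAW h')
      simp only [mem_symmDiff, mem_union, mem_shift] at *
      tauto

/-- If a flat is the disjoint union of its traces on two flats `B` and `C`, then the traces have
the same size, and their directions are common directions of `B` and `C`. -/
theorem IsFlat.trace {A B C : Finset V} (hA : IsFlat A) (hB : IsFlat B)
    (hcov : ∀ x ∈ A, x ∈ B ∧ x ∉ C ∨ x ∉ B ∧ x ∈ C) {b c : V} (hb : b ∈ A ∩ B) (hc : c ∈ A ∩ C)
    {x : V} (hx : x ∈ A ∩ B) : x + (b + c) ∈ A ∩ C := by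
  rw [mem_inter] at *
  have hA' : x + (b + c) ∈ A := by
    rw [← add_assoc]
    exact hA.2 x hx.1 b hb.1 c hc.1
  refine ⟨hA', (hcov _ hA').elim (fun h => ?_) And.right⟩
  refine absurd (hB.mem_of_eq hx.2 hb.2 h.1 (w := c) ?_) fun h => ?_
  · simp only [add_comm, add_left_comm, ZModModule.add_self, add_add_self_left, add_zero]
  · rcases hcov c hc.1 with h' | h'
    · exact h'.2 hc.2
    · exact h'.1 h

theorem IsFlat.card_trace_le {A B C : Finset V} (hA : IsFlat A) (hB : IsFlat B)
    (hcov : ∀ x ∈ A, x ∈ B ∧ x ∉ C ∨ x ∉ B ∧ x ∈ C) {b c : V} (hb : b ∈ A ∩ B)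
    (hc : c ∈ A ∩ C) : (A ∩ B).card ≤ (A ∩ C).card := by
  rw [← card_shift (b + c) (A ∩ C)]
  exact card_le_card fun x hx => mem_shift.2 (hA.trace hB hcov hb hc hx)

/-- In the situation of `IsFlat.trace`, the trace on `B` is a translate of `B ∩ C`
as soon as the sizes agree. -/
theorem IsFlat.inter_eq_shift {A B C : Finset V} (hA : IsFlat A) (hB : IsFlat B) (hC : IsFlat C)
    (hcov : ∀ x ∈ A, x ∈ B ∧ x ∉ C ∨ x ∉ B ∧ x ∈ C) {b c p : V} (hb : b ∈ A ∩ B)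
    (hc : c ∈ A ∩ C) (hp : p ∈ B ∩ C) (hcard : (B ∩ C).card ≤ (A ∩ B).card) :
    A ∩ B = shift (b + p) (B ∩ C) := by
  refine eq_of_subset_of_card_le (fun x hx => ?_) (by rwa [card_shift])
  have h1 := hA.trace hB hcov hb hc hx
  rw [mem_shift]
  rw [mem_inter] at *
  constructor
  · rw [← add_assoc]
    exact hB.2 x hx.2 b hb.2 p hp.1
  · refine hC.mem_of_eq h1.2 hc.2 hp.2 ?_
    simp only [add_comm, add_left_comm, add_add_self_left]

/-- A half `P` of a flat `Q`, glued to the complementary half of the translate of `Q`. -/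
theorem glue_half {W P Q : Finset V} {v : V} {d : ℕ} (hW : Disjoint W (shift v W)) (hP : IsFlat P)
    (hQ : IsFlat Q) (hPQ : P ⊆ Q) (hQW : Q ⊆ W) (hPd : 2 * P.card = d) (hQd : Q.card = d) :
    IsFlat (P ∪ shift v (Q \ P)) ∧ P ∪ shift v (Q \ P) ⊆ W ∪ shift v W ∧
      (P ∪ shift v (Q \ P)).card = d := by
  refine ⟨hP.union_shift_sdiff hQ hPQ (by omega) v, union_subset_union (hPQ.trans hQW)
    (shift_subset_shift (sdiff_subset.trans hQW)), ?_⟩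
  rw [card_union_of_disjoint (hW.mono (hPQ.trans hQW)
    (shift_subset_shift (sdiff_subset.trans hQW))), card_shift, card_sdiff_of_subset hPQ]
  omega

/-- Gluing a half `A` of `B` to the sum of `A` and a pair of flats `B`, `C`. -/
theorem glue_pair_of_subset {W A B C : Finset V} {v : V} {d : ℕ} (hW : Disjoint W (shift v W))
    (hA : IsFlat A) (hAW : A ⊆ W) (hAd : 2 * A.card = d) (hB : IsFlat B) (hC : IsFlat C)
    (hBW : B ⊆ W) (hCW : C ⊆ W) (hBd : B.card = d) (hCd : C.card = d)
    (hD : 4 * (B ∩ C).card = d) (hAB : A ⊆ B) (hAC : Disjoint A C) :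
    IsFlatPair d (W ∪ shift v W) (A ∪ shift v (symmDiff A (symmDiff B C))) := by
  obtain ⟨h1, h2, h3⟩ := glue_half hW hA hB hAB hBW hAd hBd
  refine ⟨_, shift v C, h1, hC.shifted v, h2,
    (shift_subset_shift hCW).trans subset_union_right, h3, by simpa, ?_, ?_⟩
  · have : (A ∪ shift v (B \ A)) ∩ shift v C = shift v (B ∩ C) := by
      ext x
      have := fun h h' => disjoint_left.1 hW (@hAW x h) (shift_subset_shift hCW h')
      have : x + v ∈ A → x + v ∉ C := fun h => disjoint_left.1 hAC h
      simp only [mem_inter, mem_union, mem_shift, mem_sdiff] at *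
      grind
    rw [this, card_shift, hD]
  · ext x
    have := fun h h' => disjoint_left.1 hW (@hAW x h) (shift_subset_shift hCW h')
    have := fun h h' => disjoint_left.1 hW (@hAW x h) (shift_subset_shift hBW h')
    have : x + v ∈ A → x + v ∉ C := fun h => disjoint_left.1 hAC h
    have := @hAB (x + v)
    simp only [mem_symmDiff, mem_union, mem_shift, mem_sdiff] at *
    grind

/-- Gluing a flat `A` on one half to the sum of `A` and a pair of flats on the other half. -/
theorem glue_pair {W A G : Finset V} {v : V} {d : ℕ} (hd : 0 < d) (hW : Disjoint W (shift v W))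
    (hA : IsFlat A) (hAW : A ⊆ W) (hG : IsFlatPair d W G) (hAd : 2 * A.card = d)
    (hS : 2 * (A ∪ shift v (symmDiff A G)).card ≤ 3 * d) :
    IsFlatPair d (W ∪ shift v W) (A ∪ shift v (symmDiff A G)) := by
  have hGc := hG.two_mul_card
  obtain ⟨B, C, hB, hC, hBW, hCW, hBd, hCd, hD, rfl⟩ := hG
  have hGW : symmDiff B C ⊆ W := symmDiff_subset_union.trans (union_subset hBW hCW)
  have hc := card_union_shift_symmDiff hW hAW hGW
  have hAG : A ⊆ symmDiff B C := by
    rw [← inter_eq_left]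
    exact eq_of_subset_of_card_le inter_subset_left (by omega)
  have hcov : ∀ x ∈ A, x ∈ B ∧ x ∉ C ∨ x ∉ B ∧ x ∈ C := fun x hx => by
    have := hAG hx
    rw [mem_symmDiff] at this
    tauto
  by_cases hAB : (A ∩ B).Nonempty
  swap
  · rw [symmDiff_comm B C]
    refine glue_pair_of_subset hW hA hAW hAd hC hB hCW hBW hCd hBd (by rwa [inter_comm])
      (fun x hx => ?_)
      (disjoint_iff_inter_eq_empty.2 (not_nonempty_iff_eq_empty.1 hAB))
    exact ((hcov x hx).resolve_left fun h => hAB ⟨x, mem_inter.2 ⟨hx, h.1⟩⟩).2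
  by_cases hAC : (A ∩ C).Nonempty
  swap
  · refine glue_pair_of_subset hW hA hAW hAd hB hC hBW hCW hBd hCd hD (fun x hx => ?_)
      (disjoint_iff_inter_eq_empty.2 (not_nonempty_iff_eq_empty.1 hAC))
    exact ((hcov x hx).resolve_right fun h => hAC ⟨x, mem_inter.2 ⟨hx, h.2⟩⟩).1
  obtain ⟨b, hb⟩ := hAB
  obtain ⟨c, hc⟩ := hAC
  obtain ⟨p, hp⟩ := card_pos.1 (show 0 < (B ∩ C).card by omega)
  have hcov' : ∀ x ∈ A, x ∈ C ∧ x ∉ B ∨ x ∉ C ∧ x ∈ B := fun x hx => by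
    have := hcov x hx
    tauto
  have e1 := hA.card_trace_le hB hcov hb hc
  have e2 := hA.card_trace_le hC hcov' hc hb
  have e3 : A.card = (A ∩ B).card + (A ∩ C).card := by
    rw [← card_union_of_disjoint]
    · congr 1
      ext x
      have := hcov x
      simp only [mem_union, mem_inter]
      tauto
    · rw [disjoint_left]
      intro x hx hx'
      have := hcov x
      simp only [mem_inter] at *
      tauto
  have s1 := hA.inter_eq_shift hB hC hcov hb hc hp (by omega)
  have s2 := hA.inter_eq_shift hC hB hcov' hc hb (by rwa [inter_comm]) (by
    rw [inter_comm C B]; omega)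
  have hDf : IsFlat (B ∩ C) := hB.inter hC ⟨p, hp⟩
  have f1 : IsFlat (B ∩ C ∪ A ∩ B) := s1 ▸ hDf.union_shift _
  have f2 : IsFlat (B ∩ C ∪ A ∩ C) := by
    rw [s2, inter_comm C B]
    exact hDf.union_shift _
  have d1 : Disjoint (B ∩ C) (A ∩ B) := by
    rw [disjoint_left]
    intro x hx hx'
    have := hcov x
    simp only [mem_inter] at *
    tauto
  have d2 : Disjoint (B ∩ C) (A ∩ C) := by
    rw [disjoint_left]
    intro x hx hx'
    have := hcov x
    simp only [mem_inter] at *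
    tauto
  obtain ⟨h1, h1', h1''⟩ := glue_half hW f1 hB (union_subset inter_subset_left inter_subset_right)
    hBW
    (by rw [card_union_of_disjoint d1]; omega) hBd
  obtain ⟨h2, h2', h2''⟩ := glue_half hW f2 hC (union_subset inter_subset_right inter_subset_right)
    hCW
    (by rw [card_union_of_disjoint d2]; omega) hCd
  refine ⟨_, _, h1, h2, h1', h2', h1'', h2'', ?_, ?_⟩
  · rw [← hD]
    congr 2
    ext x
    have := hcov x
    have := fun h h' => disjoint_left.1 hW (@hBW x h) (shift_subset_shift hCW h')
    have := fun h h' => disjoint_left.1 hW (@hCW x h) (shift_subset_shift hBW h')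
    simp only [mem_union, mem_inter, mem_shift, mem_sdiff] at *
    clear s1 s2
    grind
  · ext x
    have := hcov x
    have := hcov (x + v)
    have := fun h h' => disjoint_left.1 hW (@hBW x h) (shift_subset_shift hCW h')
    have := fun h h' => disjoint_left.1 hW (@hCW x h) (shift_subset_shift hBW h')
    simp only [mem_symmDiff, mem_union, mem_inter, mem_shift, mem_sdiff] at *
    grind

end Pairs

section Degree

variable {V : Type*} [AddCommGroup V]

/-- `DegLT s W f` says that all `s`-fold derivatives of `f` along directions of the flat `W`
vanish on `W`, i.e. that `f` has degree less than `s` on `W`. -/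
def DegLT : ℕ → Finset V → (V → ZMod 2) → Prop
  | 0, W, f => ∀ x ∈ W, f x = 0
  | s + 1, W, f => ∀ a ∈ W, ∀ b ∈ W, DegLT s W fun x => f x + f (x + (a + b))

theorem DegLT.mono {s : ℕ} {W W' : Finset V} {f : V → ZMod 2} (h : DegLT s W f) (hW : W' ⊆ W) :
    DegLT s W' f := by
  induction s generalizing f with
  | zero => exact fun x hx => h x (hW hx)
  | succ s ih => exact fun a ha b hb => ih (h a (hW ha) b (hW hb))

theorem eq_zero_or_one (x : ZMod 2) : x = 0 ∨ x = 1 := by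
  revert x
  decide

variable [Module (ZMod 2) V]

theorem AddChar.apply_eq_or_neg (ψ : AddChar V ℂ) (x y : V) : ψ x = ψ y ∨ ψ x = -ψ y := by
  refine sq_eq_sq_iff_eq_or_eq_neg.1 ?_
  rw [sq, sq, ← AddChar.map_add_eq_mul, ← AddChar.map_add_eq_mul, ZModModule.add_self,
    ZModModule.add_self]

variable [DecidableEq V]

theorem AddChar.exists_sum_ne_zero [Fintype V] {S : Finset V} {x y : V} (hx : x ∈ S)
    (hy : y ∉ S) : ∃ ψ : AddChar V ℂ, ψ x ≠ ψ y ∧ ∑ s ∈ S, ψ s ≠ 0 := by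
  by_contra! h
  have h0 : ∑ ψ : AddChar V ℂ, (∑ s ∈ S, ψ s) * (ψ x - ψ y) = 0 :=
    sum_eq_zero fun ψ _ => by
      by_cases hψ : ψ x = ψ y
      · rw [hψ, sub_self, mul_zero]
      · rw [h ψ hψ, zero_mul]
  have key : ∀ z, ∑ ψ : AddChar V ℂ, (∑ s ∈ S, ψ s) * ψ z =
      if z ∈ S then (Fintype.card V : ℂ) else 0 := by
    intro z
    simp_rw [sum_mul, ← AddChar.map_add_eq_mul]
    rw [sum_comm]
    simp_rw [AddChar.sum_apply_eq_ite, ← ZModModule.sub_eq_add, sub_eq_zero]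
    simp
  simp_rw [mul_sub, sum_sub_distrib, key, if_pos hx, if_neg hy] at h0
  simp at h0

/-- A nonempty proper subset of a flat is unevenly split by some pair of parallel hyperplanes. -/
theorem IsFlat.exists_split [Fintype V] {W S : Finset V} (hW : IsFlat W) (hSW : S ⊆ W)
    (hS : S.Nonempty) (hne : S ≠ W) : ∃ (W₀ : Finset V) (a b : V), a ∈ W ∧ b ∈ W ∧ IsFlat W₀ ∧
      W = W₀ ∪ shift (a + b) W₀ ∧ Disjoint W₀ (shift (a + b) W₀) ∧
      (S ∩ W₀).card < (S ∩ shift (a + b) W₀).card := by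
  obtain ⟨x, hx⟩ := hS
  obtain ⟨y, hyW, hy⟩ := exists_of_ssubset (hSW.ssubset_of_ne hne)
  obtain ⟨ψ, hψ, hsum⟩ := AddChar.exists_sum_ne_zero hx hy
  have hxy : ψ x = -ψ y := (AddChar.apply_eq_or_neg ψ x y).resolve_left hψ
  let H : V → Finset V := fun z => W.filter fun w => ψ w = ψ z
  have half : ∀ {a b}, a ∈ W → b ∈ W → ψ a = -ψ b → IsFlat (H a) ∧ H b = shift (a + b) (H a) ∧
      W = H a ∪ H b ∧ Disjoint (H a) (H b) := by
    intro a b ha hb hab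
    have hz : ∀ z, ψ z * ψ z = 1 := fun z => by
      rw [← AddChar.map_add_eq_mul, ZModModule.add_self, AddChar.map_zero_eq_one]
    have h0 : ψ b ≠ 0 := fun h => by simpa [h] using hz b
    refine ⟨⟨⟨a, by simp [H, ha]⟩, ?_⟩, ?_, ?_, ?_⟩
    · intro x hx y hy z hz'
      simp only [H, mem_filter] at *
      refine ⟨hW.2 x hx.1 y hy.1 z hz'.1, ?_⟩
      rw [AddChar.map_add_eq_mul, AddChar.map_add_eq_mul, hx.2, hy.2, hz'.2, hz, one_mul]
    · ext z
      simp only [H, mem_filter, mem_shift, AddChar.map_add_eq_mul]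
      refine and_congr ⟨fun h => ?_, fun h => ?_⟩ ?_
      · rw [← add_assoc]
        exact hW.2 z h a ha b hb
      · refine hW.mem_of_eq h ha hb ?_
        simp only [add_comm, add_left_comm, add_add_self_left]
      · rw [hab]
        have := hz b
        constructor <;> intro h
        · rw [h]; linear_combination -ψ b * this
        · linear_combination -h - ψ z * this
    · ext z
      have := AddChar.apply_eq_or_neg ψ z b
      rw [← hab] at this
      simp only [H, mem_union, mem_filter]
      tauto
    · rw [disjoint_left]
      intro z hz' hz''
      simp only [H, mem_filter] at *
      have h1 : ψ a = ψ b := hz'.2.symm.trans hz''.2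
      rw [hab] at h1
      exact h0 (self_eq_neg.1 h1.symm)
  obtain ⟨f1, s1, u1, d1⟩ := half (hSW hx) hyW hxy
  obtain ⟨f2, s2, u2, d2⟩ := half hyW (hSW hx) (by rw [hxy, neg_neg])
  have hcard : (S ∩ H x).card ≠ (S ∩ H y).card := by
    intro h
    refine hsum ?_
    have hS' : S = (S ∩ H x) ∪ (S ∩ H y) := by
      rw [← inter_union_distrib_left, ← u1, inter_eq_left.2 hSW]
    rw [hS', sum_union (d1.mono inter_subset_right inter_subset_right),
      sum_congr rfl (g := fun _ => ψ x) (fun z hz => (mem_filter.1 (mem_inter.1 hz).2).2),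
      sum_congr rfl (s₁ := S ∩ H y) (g := fun _ => ψ y)
        (fun z hz => (mem_filter.1 (mem_inter.1 hz).2).2), sum_const, sum_const, h, hxy]
    simp
  rcases lt_or_gt_of_ne hcard with h | h
  · exact ⟨H x, x, y, hSW hx, hyW, f1, by rw [← s1, ← u1], by rwa [← s1], by rwa [← s1]⟩
  · exact ⟨H y, y, x, hyW, hSW hx, f2, by rw [← s2, ← u2], by rwa [← s2], by rwa [← s2]⟩

/-- A function of degree at most `r` on a flat of dimension `r + k` whose support is nonempty and
has at most `3 / 2 * 2 ^ k` points is supported by a flat of dimension `k` or by a pair of flats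
of dimension `k` that meet in a flat of dimension `k - 2`. -/
theorem DegLT.support_classification [Fintype V] {n : ℕ} : ∀ {r k : ℕ} {W : Finset V}
    {f : V → ZMod 2}, r + k = n → IsFlat W → W.card = 2 ^ n → DegLT (r + 1) W f →
    (W.filter (f · = 1)).Nonempty → 2 * (W.filter (f · = 1)).card ≤ 3 * 2 ^ k →
    (IsFlat (W.filter (f · = 1)) ∧ (W.filter (f · = 1)).card = 2 ^ k) ∨
      IsFlatPair (2 ^ k) W (W.filter (f · = 1)) := by
  induction n with
  | zero =>
    intro r k W f hn hW hcard hf hS hle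
    obtain ⟨rfl, rfl⟩ : r = 0 ∧ k = 0 := by omega
    have : W.filter (f · = 1) = W :=
      eq_of_subset_of_card_le (filter_subset _ _) (by
        have := hS.card_pos
        rw [hcard, pow_zero]
        exact this)
    rw [this]
    exact Or.inl ⟨hW, hcard⟩
  | succ n ih =>
    intro r k W f hn hW hcard hf hS hle
    rcases r with _ | r
    · have : W.filter (f · = 1) = W := by
        obtain ⟨x, hx⟩ := hS
        rw [mem_filter] at hx
        refine filter_true_of_mem fun y hy => ?_
        have h := hf x hx.1 y hy x hx.1
        simp only [add_add_self_left, hx.2] at h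
        rcases eq_zero_or_one (f y) with h' | h'
        · simp [h'] at h
        · exact h'
      rw [this]
      exact Or.inl ⟨hW, by rw [hcard, ← hn, zero_add]⟩
    rcases k with _ | k
    · have h1 : (W.filter (f · = 1)).card = 1 := by
        have := hS.card_pos
        omega
      obtain ⟨x, hx⟩ := card_eq_one.1 h1
      refine Or.inl ⟨?_, h1⟩
      rw [hx]
      refine ⟨singleton_nonempty x, ?_⟩
      simp [ZModModule.add_self]
    obtain rfl : n = r + k + 1 := by omega
    have hpos : 0 < 2 ^ k := by positivity
    have hpos' : 2 ^ k ≤ 2 ^ (r + k) := Nat.pow_le_pow_right (by norm_num) (by omega)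
    obtain ⟨W₀, a, b, ha, hb, hW₀, hWu, hdis, hlt⟩ :=
      hW.exists_split (filter_subset (f · = 1) W) hS (fun h => by
        rw [h, hcard, pow_succ, pow_succ, pow_succ] at hle; omega)
    generalize hv : a + b = v at *
    have hcard₀ : W₀.card = 2 ^ (r + k + 1) := by
      rw [hWu, card_union_of_disjoint hdis, card_shift, pow_succ] at hcard
      omega
    have hsub : W₀ ⊆ W := hWu ▸ subset_union_left
    have hsub' : shift v W₀ ⊆ W := hWu ▸ subset_union_right
    obtain ⟨A, hA⟩ : ∃ A, A = W₀.filter (f · = 1) := ⟨_, rfl⟩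
    obtain ⟨G, hG⟩ : ∃ G, G = W₀.filter (fun x => f x + f (x + v) = 1) := ⟨_, rfl⟩
    have hSA : W.filter (f · = 1) ∩ W₀ = A := by
      ext x
      have := @hsub x
      simp only [hA, mem_inter, mem_filter]
      tauto
    have hSG : W.filter (f · = 1) ∩ shift v W₀ = shift v (symmDiff A G) := by
      ext x
      have h1 := @hsub' x
      have h2 : x + v + v = x := by rw [add_assoc, ZModModule.add_self, add_zero]
      simp only [hA, hG, mem_inter, mem_filter, mem_shift, mem_symmDiff, h2] at *
      rcases eq_zero_or_one (f x) with h | h <;> rcases eq_zero_or_one (f (x + v)) with h' | h' <;>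
        simp [h, h'] <;> tauto
    have hSu : W.filter (f · = 1) = A ∪ shift v (symmDiff A G) := by
      rw [← hSG, ← hSA, ← inter_union_distrib_left, ← hWu]
      exact (inter_eq_left.2 (filter_subset _ _)).symm
    rw [hSA, hSG, card_shift] at hlt
    have hAW : A ⊆ W₀ := hA ▸ filter_subset _ _
    have hGW : G ⊆ W₀ := hG ▸ filter_subset _ _
    have hScard : (W.filter (f · = 1)).card = A.card + (symmDiff A G).card := by
      rw [hSu, card_union_of_disjoint, card_shift]
      exact hdis.mono hAW (shift_subset_shift (symmDiff_subset_union.trans (union_subset hAW hGW)))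
    have hGne : G.Nonempty := by
      rw [nonempty_iff_ne_empty]
      intro h
      rw [h, ← bot_eq_empty, symmDiff_bot] at hlt
      omega
    have hGcard : G.card ≤ A.card + (symmDiff A G).card := by
      have := card_symmDiff_add A (symmDiff A G)
      rw [symmDiff_symmDiff_cancel_left] at this
      omega
    have hGdeg : DegLT (r + 1) W₀ fun x => f x + f (x + v) := hv ▸ (hf a ha b hb).mono hsub
    have hGc := ih (r := r) (k := k + 1) (by omega) hW₀ hcard₀ hGdeg (hG ▸ hGne)
      (by rw [← hG]; omega)
    rw [← hG] at hGc
    rw [hSu] at hle ⊢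
    rcases A.eq_empty_or_nonempty with hA0 | hAne
    · rw [hA0, ← bot_eq_empty, bot_symmDiff, bot_eq_empty, empty_union]
      rcases hGc with h | h
      · exact Or.inl ⟨h.1.shifted v, by rw [card_shift, h.2]⟩
      · exact Or.inr ((h.shifted v).mono hsub')
    · have hAc := ih (r := r + 1) (k := k) (by omega) hW₀ hcard₀ (hf.mono hsub) (hA ▸ hAne) (by
        rw [← hA]
        rw [← hSu, hScard, pow_succ] at hle
        omega)
      rw [← hA] at hAc
      have hAflat : IsFlat A ∧ A.card = 2 ^ k := hAc.resolve_right fun h => by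
        have := h.two_mul_card
        rw [← hSu, hScard, pow_succ] at hle
        omega
      have hAd : 2 * A.card = 2 ^ (k + 1) := by rw [hAflat.2, pow_succ, mul_comm]
      rw [hWu]
      rcases hGc with h | h
      · exact glue_flat hdis hAflat.1 h.1 hAW hGW hAd h.2 hle
      · exact Or.inr (glue_pair (by positivity) hdis hAflat.1 hAW h hAd hle)

end Degree

section ReedMuller

theorem DegLT.zero {V : Type*} [AddCommGroup V] (s : ℕ) (W : Finset V) :
    DegLT s W fun _ => 0 := by
  induction s with
  | zero => exact fun _ _ => rfl
  | succ s ih => exact fun _ _ _ _ => ih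

theorem DegLT.add {V : Type*} [AddCommGroup V] {s : ℕ} {W : Finset V} {f g : V → ZMod 2}
    (hf : DegLT s W f) (hg : DegLT s W g) : DegLT s W fun x => f x + g x := by
  induction s generalizing f g with
  | zero => exact fun x hx => by simp only [hf x hx, hg x hx, add_zero]
  | succ s ih =>
    intro a ha b hb
    simpa only [add_add_add_comm] using ih (hf a ha b hb) (hg a ha b hb)

theorem DegLT.sum {V ι : Type*} [AddCommGroup V] {s : ℕ} {W : Finset V} (t : Finset ι)
    {f : ι → V → ZMod 2} (hf : ∀ i ∈ t, DegLT s W (f i)) :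
    DegLT s W fun x => ∑ i ∈ t, f i x := by
  classical
  induction t using Finset.induction_on with
  | empty => exact DegLT.zero s W
  | insert i t hi ih =>
    simp only [sum_insert hi]
    exact (hf i (mem_insert_self i t)).add (ih fun j hj => hf j (mem_insert_of_mem hj))

/-- The indicator function of a flat of codimension less than `s` has degree less than `s`. -/
theorem IsFlat.degLT_indicator {V : Type*} [AddCommGroup V] [Module (ZMod 2) V] [DecidableEq V]
    [Fintype V] {s : ℕ} {A : Finset V} (hA : IsFlat A) (hs : Fintype.card V < A.card * 2 ^ s) :
    DegLT s univ fun x => if x ∈ A then 1 else 0 := by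
  induction s generalizing A with
  | zero => exact absurd (card_le_univ A) (by omega)
  | succ s ih =>
    intro a _ b _
    by_cases h : ∃ x ∈ A, x + (a + b) ∉ A
    · obtain ⟨x, hx, hxt⟩ := h
      have hd := hA.disjoint_shift hx hxt
      convert ih (hA.union_shift (a + b)) (by
        rw [hA.card_union_shift hx hxt]
        rw [pow_succ] at hs
        linarith) using 2 with y
      have h1 : y ∈ A → y ∉ shift (a + b) A := fun h => disjoint_left.1 hd h
      simp only [mem_union, mem_shift] at *
      by_cases hy : y ∈ A <;> by_cases hyt : y + (a + b) ∈ A <;> simp_all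
    · push Not at h
      convert DegLT.zero s univ using 2 with y
      have h1 := h y
      have h2 := h (y + (a + b))
      rw [add_assoc, ZModModule.add_self, add_zero] at h2
      by_cases hy : y ∈ A
      · simp [hy, h1 hy, ZModModule.add_self]
      · simp [hy, mt h2 hy]

theorem card_filter_forall_mem_eq_one {m : ℕ} (T : Finset (Fin m)) :
    (univ.filter fun x : Fin m → ZMod 2 => ∀ i ∈ T, x i = 1).card * 2 ^ T.card = 2 ^ m := by
  have h : (univ.filter fun x : Fin m → ZMod 2 => ∀ i ∈ T, x i = 1) =
      Fintype.piFinset fun i => if i ∈ T then {1} else univ := by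
    ext x
    simp only [mem_filter, mem_univ, true_and, Fintype.mem_piFinset]
    refine forall_congr' fun i => ?_
    by_cases hi : i ∈ T <;> simp [hi]
  have h' : ∀ i, (if i ∈ T then ({1} : Finset (ZMod 2)) else univ).card =
      if i ∈ T then 1 else 2 := fun i => by
    split_ifs <;> simp
  rw [h, Fintype.card_piFinset, prod_congr rfl fun i _ => h' i, prod_ite]
  simp only [prod_const, one_pow, one_mul]
  rw [← pow_add, filter_not, filter_mem_eq_inter, univ_inter,
    card_sdiff_add_card_eq_card (subset_univ T), card_fin]

/-- The algebraic normal form of a Boolean function. -/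
theorem sum_anf {m : ℕ} (f : BF m) (x : Fin m → ZMod 2) :
    ∑ T : Finset (Fin m), (if ∀ i ∈ T, x i = 1 then anf f T else 0) = f x := by
  simp only [anf, sum_filter]
  have h : ∀ T : Finset (Fin m), (if ∀ i ∈ T, x i = 1 then
      ∑ y, (if ∀ i, y i = 1 → i ∈ T then f y else 0) else 0) =
      ∑ y, if T ∈ Icc (univ.filter (y · = 1)) (univ.filter (x · = 1)) then f y else 0 := fun T => by
    have h1 : (∀ i ∈ T, x i = 1) ↔ T ⊆ univ.filter (x · = 1) := by simp [subset_iff]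
    have h2 : ∀ y : Fin m → ZMod 2, (∀ i, y i = 1 → i ∈ T) ↔ univ.filter (y · = 1) ⊆ T := by
      simp [subset_iff]
    simp only [h1, h2, mem_Icc]
    split_ifs with h <;> simp [h]
  rw [sum_congr rfl fun T _ => h T, sum_comm, sum_eq_single x]
  · simp
  · intro y _ hyx
    rw [← sum_filter, sum_const, filter_mem_eq_inter, univ_inter, nsmul_eq_mul]
    by_cases hsub : univ.filter (y · = 1) ⊆ univ.filter (x · = 1)
    · rw [card_Icc_finset hsub]
      have hne : univ.filter (y · = 1) ≠ univ.filter (x · = 1) := fun h => hyx <| by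
        ext i
        have hi : y i = 1 ↔ x i = 1 := by simpa using congrArg (i ∈ ·) h
        rcases eq_zero_or_one (x i) with h1 | h1 <;> rcases eq_zero_or_one (y i) with h2 | h2 <;>
          simp_all
      have := card_lt_card (hsub.ssubset_of_ne hne)
      rw [Nat.cast_pow, Nat.cast_ofNat, show (2 : ZMod 2) = 0 from rfl, zero_pow (by omega),
        zero_mul]
    · rw [Icc_eq_empty hsub, card_empty, Nat.cast_zero, zero_mul]
  · simp

theorem anf_insert {m : ℕ} (f : BF m) {i : Fin m} {T : Finset (Fin m)} (hi : i ∉ T) :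
    anf f (insert i T) = anf (fun x => f x + f (x + Pi.single i 1)) T := by
  have hu : (univ.filter fun x : Fin m → ZMod 2 => ∀ j, x j = 1 → j ∈ insert i T) =
      (univ.filter fun x => ∀ j, x j = 1 → j ∈ T) ∪
        shift (Pi.single i 1) (univ.filter fun x => ∀ j, x j = 1 → j ∈ T) := by
    ext x
    simp only [mem_filter, mem_univ, true_and, mem_union, mem_shift, mem_insert, Pi.add_apply]
    constructor
    · intro h
      rcases eq_zero_or_one (x i) with hx | hx
      · left
        intro j hj
        refine (h j hj).resolve_left ?_
        rintro rfl
        simp [hx] at hj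
      · right
        intro j hj
        rcases eq_or_ne j i with rfl | hji
        · simp [hx, show (1 : ZMod 2) + 1 = 0 from rfl] at hj
        · rw [Pi.single_eq_of_ne hji, add_zero] at hj
          exact (h j hj).resolve_left hji
    · rintro (h | h) j hj
      · exact Or.inr (h j hj)
      · rcases eq_or_ne j i with rfl | hji
        · exact Or.inl rfl
        · refine Or.inr (h j ?_)
          rwa [Pi.single_eq_of_ne hji, add_zero]
  have hd : Disjoint (univ.filter fun x : Fin m → ZMod 2 => ∀ j, x j = 1 → j ∈ T)
      (shift (Pi.single i 1) (univ.filter fun x => ∀ j, x j = 1 → j ∈ T)) := by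
    rw [disjoint_left]
    intro x hx hx'
    simp only [mem_filter, mem_univ, true_and, mem_shift] at hx hx'
    rcases eq_zero_or_one (x i) with h | h
    · exact hi (hx' i (by simp [h]))
    · exact hi (hx i h)
  rw [anf, hu, sum_union hd, shift, sum_map, anf, sum_add_distrib]
  rfl

theorem DegLT.anf_eq_zero {m s : ℕ} {f : BF m} (hf : DegLT s univ f) {T : Finset (Fin m)}
    (hT : s ≤ T.card) : anf f T = 0 := by
  induction s generalizing f T with
  | zero => exact sum_eq_zero fun x _ => hf x (mem_univ x)
  | succ s ih =>
    obtain ⟨i, hi⟩ := card_pos.1 (by omega : 0 < T.card)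
    rw [← insert_erase hi, anf_insert f (notMem_erase i T)]
    refine ih ?_ (by rw [card_erase_of_mem hi]; omega)
    simpa using hf (Pi.single i 1) (mem_univ _) 0 (mem_univ _)

/-- Membership in a Reed–Muller code in terms of derivatives. -/
theorem mem_RM_iff {r m : ℕ} {f : BF m} : f ∈ RM r m ↔ DegLT (r + 1) univ f := by
  simp only [RM, mem_filter, mem_univ, true_and]
  refine ⟨fun h => ?_, fun h T hT => h.anf_eq_zero hT⟩
  rw [← funext (sum_anf f)]
  refine DegLT.sum univ fun T _ => ?_
  rcases eq_zero_or_one (anf f T) with h0 | h1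
  · simpa only [h0, ite_self] using DegLT.zero _ _
  have hT : T.card ≤ r := by
    by_contra hT
    simp [h T (by omega)] at h1
  have hflat : IsFlat (univ.filter fun x : Fin m → ZMod 2 => ∀ i ∈ T, x i = 1) := by
    refine ⟨⟨1, by simp⟩, fun x hx y hy z hz => ?_⟩
    simp only [mem_filter, mem_univ, true_and, Pi.add_apply] at *
    exact fun i hi => by rw [hx i hi, hy i hi, hz i hi]; rfl
  convert hflat.degLT_indicator (s := r + 1) ?_ using 2 with x
  · simp [h1]
  · rw [Fintype.card_fun, ZMod.card, Fintype.card_fin, ← card_filter_forall_mem_eq_one T]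
    refine Nat.mul_lt_mul_of_pos_left (Nat.pow_lt_pow_right (by norm_num) (by omega)) ?_
    exact hflat.1.card_pos

end ReedMuller

section Frames

variable {V : Type*} [AddCommGroup V] [Module (ZMod 2) V]

/-- Six vectors with sum zero that are otherwise affinely independent modulo `D`. -/
def IsFrame (c : Fin 6 → V) (D : Submodule (ZMod 2) V) : Prop :=
  ∑ i, c i = 0 ∧ ∀ t : Fin 6 → ZMod 2, ∑ i, t i = 0 → ∑ i, t i • c i ∈ D → ∀ i j, t i = t j

/-- The union of the cosets of `D` through the points `c i`. -/
noncomputable def cosetUnion [Fintype V] [DecidableEq V] (c : Fin 6 → V)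
    (D : Submodule (ZMod 2) V) : Finset V :=
  open Classical in univ.filter fun x => ∃ i, x + c i ∈ D

@[simp]
theorem mem_cosetUnion [Fintype V] [DecidableEq V] {c : Fin 6 → V} {D : Submodule (ZMod 2) V}
    {x : V} : x ∈ cosetUnion c D ↔ ∃ i, x + c i ∈ D := by
  simp [cosetUnion]

theorem IsFrame.eq_of_add_mem {c : Fin 6 → V} {D : Submodule (ZMod 2) V} (h : IsFrame c D)
    {i j : Fin 6} (hij : c i + c j ∈ D) : i = j := by
  by_contra hne
  have h1 := h.2 (Pi.single i 1 + Pi.single j 1)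
    (by simp [sum_add_distrib]; rfl) (by simpa [add_smul, sum_add_distrib, Pi.single_apply])
  clear hij h
  revert h1 hne i j
  decide

theorem IsFrame.not_four {c : Fin 6 → V} {D : Submodule (ZMod 2) V} (h : IsFrame c D)
    {i j k : Fin 6} (hi : i ≠ 0) (hk : k ≠ 0) (hki : k ≠ i) (hj : j ≠ k) :
    c 0 + c i + (c k + c j) ∉ D := by
  intro hD
  have h1 := h.2 (Pi.single 0 1 + Pi.single i 1 + (Pi.single k 1 + Pi.single j 1))
    (by simp [sum_add_distrib]; rfl) (by simpa [add_smul, sum_add_distrib, Pi.single_apply])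
  clear hD h
  revert h1 hi hk hki hj i j k
  decide

/-- Translates of a frame by elements of `D` and permutations of a frame. -/
theorem IsFrame.congr {c c' : Fin 6 → V} {D : Submodule (ZMod 2) V} (h : IsFrame c D)
    {σ : Equiv.Perm (Fin 6)} (hc' : ∑ i, c' i = 0) (hσ : ∀ i, c' i + c (σ i) ∈ D) :
    IsFrame c' D := by
  refine ⟨hc', fun t ht htD i j => ?_⟩
  have h1 := h.2 (fun i => t (σ.symm i)) (by rwa [Equiv.sum_comp σ.symm t]) (by
    rw [← Equiv.sum_comp σ]
    simp only [Equiv.symm_apply_apply]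
    have h2 : ∑ i, t i • (c' i + c (σ i)) ∈ D := D.sum_mem fun i _ => D.smul_mem _ (hσ i)
    simp only [smul_add, sum_add_distrib] at h2
    exact (D.add_mem_iff_right htD).1 h2) (σ i) (σ j)
  simpa using h1

theorem mem_iff_of_add_mem {D : Submodule (ZMod 2) V} {x y : V} (h : x + y ∈ D) :
    x ∈ D ↔ y ∈ D :=
  ⟨fun hx => (D.add_mem_iff_right hx).1 h, fun hy => (D.add_mem_iff_left hy).1 h⟩

theorem add_add_add_cancel_middle (x y z : V) : x + y + (y + z) = x + z := by
  rw [add_assoc, add_add_self_left]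

variable [Fintype V] [DecidableEq V]

theorem cosetUnion_congr {c c' : Fin 6 → V} {D : Submodule (ZMod 2) V} {σ : Equiv.Perm (Fin 6)}
    (hσ : ∀ i, c' i + c (σ i) ∈ D) : cosetUnion c' D = cosetUnion c D := by
  ext x
  rw [mem_cosetUnion, mem_cosetUnion, σ.surjective.exists (p := fun i => x + c i ∈ D)]
  refine exists_congr fun i => mem_iff_of_add_mem ?_
  have := hσ i
  rwa [add_comm x (c' i), add_add_add_cancel_middle]

/-- The direction of the cosets is the stabilizer of their union. -/
theorem IsFrame.mem_iff {c : Fin 6 → V} {D : Submodule (ZMod 2) V} (h : IsFrame c D) {v : V} :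
    v ∈ D ↔ ∀ x ∈ cosetUnion c D, x + v ∈ cosetUnion c D := by
  constructor
  · intro hv x hx
    rw [mem_cosetUnion] at *
    obtain ⟨i, hi⟩ := hx
    exact ⟨i, by rw [add_right_comm]; exact D.add_mem hi hv⟩
  · intro hv
    by_contra hvD
    have key : ∀ i, ∃ j, c i + v + c j ∈ D ∧ j ≠ i := fun i => by
      have hi := hv (c i) (mem_cosetUnion.2 ⟨i, by rw [ZModModule.add_self]; exact D.zero_mem⟩)
      obtain ⟨j, hj⟩ := mem_cosetUnion.1 hi
      refine ⟨j, hj, ?_⟩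
      rintro rfl
      rw [add_right_comm, ZModModule.add_self, zero_add] at hj
      exact hvD hj
    obtain ⟨i, hi, hi0⟩ := key 0
    obtain ⟨k, hk0, hki⟩ : ∃ k : Fin 6, k ≠ 0 ∧ k ≠ i := by
      clear hi
      revert i
      decide
    obtain ⟨j, hj, hjk⟩ := key k
    refine h.not_four hi0 hk0 hki hjk ?_
    have := D.add_mem hi hj
    rwa [show c 0 + v + c i + (c k + v + c j) = c 0 + c i + (c k + c j) by
      simp only [add_comm, add_left_comm, add_assoc, add_add_self_left]] at this

theorem IsFrame.eq_of_cosetUnion_eq {c c' : Fin 6 → V} {D D' : Submodule (ZMod 2) V}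
    (h : IsFrame c D) (h' : IsFrame c' D') (he : cosetUnion c' D' = cosetUnion c D) : D' = D := by
  ext v
  rw [h.mem_iff, h'.mem_iff, he]

/-- Two frames with the same union of cosets are equivalent. -/
theorem IsFrame.exists_perm {c c' : Fin 6 → V} {D : Submodule (ZMod 2) V} (h' : IsFrame c' D)
    (he : cosetUnion c' D = cosetUnion c D) :
    ∃ σ : Equiv.Perm (Fin 6), ∀ i, c' i + c (σ i) ∈ D := by
  have key : ∀ i, ∃ j, c' i + c j ∈ D := fun i => by
    rw [← mem_cosetUnion, ← he, mem_cosetUnion]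
    exact ⟨i, by rw [ZModModule.add_self]; exact D.zero_mem⟩
  choose σ hσ using key
  have hinj : σ.Injective := fun i j hij => by
    refine h'.eq_of_add_mem ?_
    have := D.add_mem (hσ i) (hσ j)
    rwa [hij, add_comm (c' j), add_add_add_cancel_middle] at this
  exact ⟨Equiv.ofBijective σ (Finite.injective_iff_bijective.1 hinj), hσ⟩

end Frames

section FramePairs

variable {V : Type*} [AddCommGroup V]

/-- Five vectors, completed by their sum. -/
def extend (a : Fin 5 → V) : Fin 6 → V := Fin.snoc a (∑ j, a j)

@[simp]
theorem extend_castSucc (a : Fin 5 → V) (j : Fin 5) : extend a j.castSucc = a j :=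
  Fin.snoc_castSucc ..

@[simp]
theorem extend_last (a : Fin 5 → V) : extend a (Fin.last 5) = ∑ j, a j :=
  Fin.snoc_last ..

theorem extend_eq (a : Fin 5 → V) :
    extend a = ![a 0, a 1, a 2, a 3, a 4, a 0 + a 1 + a 2 + a 3 + a 4] := by
  rw [← Fin.sum_univ_five]
  ext i
  fin_cases i <;> rfl

variable [Module (ZMod 2) V]

theorem sum_extend (a : Fin 5 → V) : ∑ i, extend a i = 0 := by
  simp only [Fin.sum_univ_castSucc, extend_castSucc, extend_last, ZModModule.add_self]

theorem sum_smul_extend (a : Fin 5 → V) {t : Fin 6 → ZMod 2} (ht : ∑ i, t i = 0) :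
    ∑ i, t i • extend a i = ∑ j : Fin 4, (t j.succ.castSucc + t 5) • (a j.succ + a 0) := by
  simp only [extend_eq, Fin.sum_univ_six, Fin.sum_univ_four] at ht ⊢
  simp only [Fin.reduceSucc, Fin.reduceCastSucc, Matrix.cons_val]
  match_scalars <;> grind

/-- The frame condition in terms of differences with the first vector. -/
theorem isFrame_extend_iff {a : Fin 5 → V} {D : Submodule (ZMod 2) V} :
    IsFrame (extend a) D ↔
      ∀ g : Fin 4 → ZMod 2, ∑ j, g j • (a j.succ + a 0) ∈ D → g = 0 := by
  constructor
  · intro h g hg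
    have ht : ∑ i, (![∑ j, g j, g 0, g 1, g 2, g 3, 0] : Fin 6 → ZMod 2) i = 0 := by
      simp only [Fin.sum_univ_six, Fin.sum_univ_four, Matrix.cons_val]
      grind
    have h1 := h.2 _ ht (by
      rw [sum_smul_extend a ht]
      convert hg using 3 with j
      fin_cases j <;> simp)
    ext j
    have := h1 j.succ.castSucc 5
    fin_cases j <;> simpa using this
  · intro h
    refine ⟨sum_extend a, fun t ht htD => ?_⟩
    rw [sum_smul_extend a ht] at htD
    have h1 := h _ htD
    have h2 : ∀ j : Fin 4, t j.succ.castSucc = t 5 := fun j => by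
      have := congrFun h1 j
      rwa [Pi.zero_apply, ← ZModModule.sub_eq_add, sub_eq_zero] at this
    have h3 : ∀ i, t i = t 5 := by
      rw [Fin.sum_univ_six] at ht
      have a1 := h2 0
      have a2 := h2 1
      have a3 := h2 2
      have a4 := h2 3
      simp only [Fin.reduceSucc, Fin.reduceCastSucc] at a1 a2 a3 a4
      intro i
      fin_cases i <;> simp only [Fin.reduceFinMk, Fin.isValue, Fin.zero_eta, Fin.mk_one] <;> grind
    exact fun i j => (h3 i).trans (h3 j).symm

theorem linearIndependent_iff_append {m n : ℕ} {w : Fin (m + n) → V} :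
    LinearIndependent (ZMod 2) w ↔ LinearIndependent (ZMod 2) (fun k => w (Fin.natAdd m k)) ∧
      ∀ g : Fin m → ZMod 2, ∑ j, g j • w (Fin.castAdd n j) ∈
        Submodule.span (ZMod 2) (Set.range fun k => w (Fin.natAdd m k)) → g = 0 := by
  simp only [Fintype.linearIndependent_iff, Submodule.mem_span_range_iff_exists_fun,
    Fin.sum_univ_add]
  constructor
  · intro h
    constructor
    · intro g hg i
      have := h (Fin.append 0 g) (by simpa using hg) (Fin.natAdd m i)
      simpa using this
    · rintro g ⟨g', hg⟩
      ext j
      have := h (Fin.append g g') (by simp [hg, ZModModule.add_self]) (Fin.castAdd n j)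
      simpa using this
  · rintro ⟨h1, h2⟩ g hg
    have h3 := h2 (fun j => g (Fin.castAdd n j)) ⟨fun k => g (Fin.natAdd m k), by
      rwa [← ZModModule.sub_eq_add, sub_eq_zero, eq_comm] at hg⟩
    have h4 := fun j => congrFun h3 j
    simp only [Pi.zero_apply] at h4
    simp only [h4, zero_smul, sum_const_zero, zero_add] at hg
    intro i
    induction i using Fin.addCases with
    | left j => exact h4 j
    | right k => exact h1 (fun k => g (Fin.natAdd m k)) hg k

variable [DecidableEq V]

/-- A flat is a union of four translates of a subflat with a quarter of the points. -/
theorem IsFlat.exists_quarters {P B : Finset V} (hP : IsFlat P) (hB : IsFlat B) (hPB : P ⊆ B)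
    (hc : B.card = 4 * P.card) {p : V} (hp : p ∈ P) : ∃ u v, p + u ∉ P ∧ p + v ∉ P ∪ shift u P ∧
      B = P ∪ shift u P ∪ shift v (P ∪ shift u P) := by
  have hpos := card_pos.2 hP.1
  have step : ∀ {P : Finset V}, IsFlat P → P ⊆ B → P.card < B.card → p ∈ P →
      ∃ u, p + u ∉ P ∧ P ∪ shift u P ⊆ B := by
    intro P hP hPB hlt hp
    obtain ⟨b, hb, hbP⟩ := exists_mem_notMem_of_card_lt_card hlt
    exact ⟨p + b, by rwa [add_add_self_left], hB.union_shift_subset hPB (hPB hp) hb⟩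
  obtain ⟨u, hu, huB⟩ := step hP hPB (by omega) hp
  have h1 := hP.card_union_shift hp hu
  obtain ⟨v, hv, hvB⟩ := step (hP.union_shift u) huB (by omega) (mem_union_left _ hp)
  have h2 := (hP.union_shift u).card_union_shift (mem_union_left _ hp) hv
  exact ⟨u, v, hu, hv, (eq_of_subset_of_card_le hvB (by omega)).symm⟩

end FramePairs

section PairsOfFrames

variable {V : Type*} [AddCommGroup V] [Module (ZMod 2) V]

/-- The direction of a flat. -/
def IsFlat.direction {P : Finset V} (hP : IsFlat P) {p : V} (hp : p ∈ P) :
    Submodule (ZMod 2) V where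
  carrier := {x | x + p ∈ P}
  zero_mem' := by simpa using hp
  add_mem' {x y} hx hy := by
    refine hP.mem_of_eq hx hy hp ?_
    simp only [add_comm, add_left_comm, add_add_self_left]
  smul_mem' c x hx := by
    rcases eq_zero_or_one c with rfl | rfl
    · simpa using hp
    · simpa using hx

@[simp]
theorem IsFlat.mem_direction {P : Finset V} (hP : IsFlat P) {p : V} (hp : p ∈ P) {x : V} :
    x ∈ hP.direction hp ↔ x + p ∈ P :=
  Iff.rfl

theorem IsFlat.card_direction {P : Finset V} (hP : IsFlat P) {p : V} (hp : p ∈ P) :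
    Nat.card (hP.direction hp) = P.card :=
  (Nat.subtype_card (shift p P) fun _ => mem_shift).trans (card_shift p P)

theorem add_mem_direction_iff {P : Finset V} (hP : IsFlat P) {p : V} (hp : p ∈ P) {x u : V} :
    x + (p + u) ∈ hP.direction hp ↔ x + u ∈ P := by
  rw [hP.mem_direction]
  simp only [add_comm, add_left_comm, add_add_self_left]

theorem smul_add_smul_mem {D : Submodule (ZMod 2) V} {u v : V} (hu : u ∉ D) (hv : v ∉ D)
    (huv : u + v ∉ D) {α β : ZMod 2} (h : α • u + β • v ∈ D) : α = 0 ∧ β = 0 := by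
  rcases eq_zero_or_one α with rfl | rfl <;> rcases eq_zero_or_one β with rfl | rfl <;> simp_all

theorem exists_fin_six {p : Fin 6 → Prop} :
    (∃ i, p i) ↔ p 0 ∨ p 1 ∨ p 2 ∨ p 3 ∨ p 4 ∨ p 5 := by
  simp only [Fin.exists_fin_succ, Fin.isValue, IsEmpty.exists_iff, or_false]
  rfl

variable [DecidableEq V]

theorem IsFlatPair.exists_frame [Fintype V] {d : ℕ} (hd : 0 < d) {S : Finset V}
    (h : IsFlatPair (4 * d) univ S) : ∃ (c : Fin 6 → V) (D : Submodule (ZMod 2) V),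
      Nat.card D = d ∧ IsFrame c D ∧ S = cosetUnion c D := by
  obtain ⟨B, C, hB, hC, -, -, hBd, hCd, hP, rfl⟩ := h
  obtain ⟨p, hp⟩ := card_pos.1 (by omega : 0 < (B ∩ C).card)
  have hPf : IsFlat (B ∩ C) := hB.inter hC ⟨p, hp⟩
  obtain ⟨u, v, hu, hv, hBu⟩ := hPf.exists_quarters hB inter_subset_left (by omega) hp
  obtain ⟨u', v', hu', hv', hCu⟩ := hPf.exists_quarters hC inter_subset_right (by omega) hp
  obtain ⟨hpB, hpC⟩ := mem_inter.1 hp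
  have hQ := fun x => mem_inter (a := x) (s₁ := B) (s₂ := C)
  have mem_iff : ∀ {Q : Finset V} {u v : V},
      Q = (B ∩ C) ∪ shift u (B ∩ C) ∪ shift v ((B ∩ C) ∪ shift u (B ∩ C)) → ∀ x,
      x ∈ Q ↔ x ∈ B ∩ C ∨ x + u ∈ B ∩ C ∨ x + v ∈ B ∩ C ∨ x + (u + v) ∈ B ∩ C := by
    intro Q u v hQ x
    conv_lhs => rw [hQ]
    simp only [mem_union, mem_shift, or_assoc, add_assoc, add_comm v]
  have not_mem : ∀ {u v : V}, p + u ∉ B ∩ C → p + v ∉ (B ∩ C) ∪ shift u (B ∩ C) →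
      ∀ x ∈ B ∩ C, x + u ∉ B ∩ C ∧ x + v ∉ B ∩ C ∧ x + (u + v) ∉ B ∩ C := by
    intro u v hu hv x hx
    simp only [mem_union, mem_shift, not_or, add_assoc, add_comm v] at hv
    rw [hPf.add_mem_iff hp hx] at hu hv
    rw [hPf.add_mem_iff hp hx] at hv
    exact ⟨hu, hv⟩
  generalize B ∩ C = P at *
  have hBm := mem_iff hBu
  have hCm := mem_iff hCu
  have hBn := not_mem hu hv
  have hCn := not_mem hu' hv'
  refine ⟨![p + u, p + v, p + (u + v), p + u', p + v', p + (u' + v')], hPf.direction hp, ?_,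
    ⟨?_, fun t ht htD => ?_⟩, ?_⟩
  · rw [hPf.card_direction]
    omega
  · simp only [Fin.sum_univ_six, Matrix.cons_val]
    simp only [add_comm, add_left_comm, add_assoc, add_add_self_left, ZModModule.add_self]
  · have h1 : ∑ i, t i • (![p + u, p + v, p + (u + v), p + u', p + v', p + (u' + v')] :
        Fin 6 → V) i = ((t 0 + t 2) • u + (t 1 + t 2) • v) + ((t 3 + t 5) • u' + (t 4 + t 5) • v') := by
      simp only [Fin.sum_univ_six, Matrix.cons_val] at ht ⊢
      match_scalars <;> grind
    rw [h1] at htD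
    obtain ⟨n1, n2, n3⟩ := hBn p hp
    obtain ⟨n1', n2', n3'⟩ := hCn p hp
    have hle : ∀ {Q : Finset V} (hQf : IsFlat Q) (hpQ : p ∈ Q) {u v : V} (α β : ZMod 2),
        (∀ x, x ∈ Q ↔ x ∈ P ∨ x + u ∈ P ∨ x + v ∈ P ∨ x + (u + v) ∈ P) →
        α • u + β • v ∈ hQf.direction hpQ := by
      intro Q hQf hpQ u v α β hQm
      refine add_mem (Submodule.smul_mem _ _ ?_) (Submodule.smul_mem _ _ ?_) <;>
        rw [IsFlat.mem_direction, add_comm, hQm]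
      · simp [add_assoc, ZModModule.add_self, hp]
      · simp [add_assoc, ZModModule.add_self, hp]
    have mB := hle hB hpB (t 0 + t 2) (t 1 + t 2) hBm
    have mC := hle hC hpC (t 3 + t 5) (t 4 + t 5) hCm
    have hPB : hPf.direction hp ≤ hB.direction hpB := fun x hx => ((hQ _).1 hx).1
    have hPC : hPf.direction hp ≤ hC.direction hpC := fun x hx => ((hQ _).1 hx).2
    have e1 : (t 0 + t 2) • u + (t 1 + t 2) • v ∈ hPf.direction hp :=
      (hQ _).2 ⟨mB, (Submodule.add_mem_iff_left _ mC).1 (hPC htD)⟩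
    have e2 : (t 3 + t 5) • u' + (t 4 + t 5) • v' ∈ hPf.direction hp :=
      (Submodule.add_mem_iff_right _ e1).1 htD
    rw [add_comm, ← hPf.mem_direction hp] at n1 n2 n3 n1' n2' n3'
    obtain ⟨q1, q2⟩ := smul_add_smul_mem n1 n2 n3 e1
    obtain ⟨q3, q4⟩ := smul_add_smul_mem n1' n2' n3' e2
    rw [Fin.sum_univ_six] at ht
    have h3 : ∀ i, t i = t 5 := by
      intro i
      fin_cases i <;> simp only [Fin.reduceFinMk, Fin.isValue, Fin.zero_eta, Fin.mk_one] <;> grind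
    exact fun i j => (h3 i).trans (h3 j).symm
  · ext x
    simp only [mem_cosetUnion, exists_fin_six, Matrix.cons_val, add_mem_direction_iff]
    have hsd : ∀ {a b c q r : Prop}, (q ↔ x ∈ P ∨ a ∨ b ∨ c) → (x ∈ P → ¬a ∧ ¬b ∧ ¬c) →
        (x ∈ P ↔ q ∧ r) → (q ∧ ¬r ↔ a ∨ b ∨ c) := by
      tauto
    rw [mem_symmDiff, hsd (hBm x) (hBn x) (hQ x), hsd (hCm x) (hCn x) ((hQ x).trans and_comm)]
    simp only [or_assoc]

theorem IsFrame.isFlatPair [Fintype V] {d : ℕ} {c : Fin 6 → V} {D : Submodule (ZMod 2) V}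
    (hD : Nat.card D = d) (h : IsFrame c D) : IsFlatPair (4 * d) univ (cosetUnion c D) := by
  classical
  obtain ⟨P, hP⟩ : ∃ P : Finset V, ∀ x, x ∈ P ↔ x ∈ D := ⟨univ.filter (· ∈ D), by simp⟩
  have hPf : IsFlat P := ⟨⟨0, (hP 0).2 D.zero_mem⟩, fun x hx y hy z hz => by
    rw [hP] at *
    exact D.add_mem (D.add_mem hx hy) hz⟩
  have hPc : P.card = d := by rw [← hD, ← Nat.subtype_card P hP]
  have quad : ∀ i j k : Fin 6, i ≠ j → i ≠ k → j ≠ k → ∃ B : Finset V, IsFlat B ∧ B.card = 4 * d ∧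
      ∀ x, x ∈ B ↔ x + c i ∈ D ∨ x + c j ∈ D ∨ x + c k ∈ D ∨ x + (c i + c j + c k) ∈ D := by
    intro i j k hij hik hjk
    have h1 := hPf.shifted (c i)
    have hi : c i ∈ shift (c i) P := by simp [hP, ZModModule.add_self]
    have hj : c i + (c i + c j) ∉ shift (c i) P := by
      rw [add_add_self_left, mem_shift, hP]
      exact fun hD => hij (h.eq_of_add_mem hD).symm
    have hk : c i + (c i + c k) ∉ shift (c i) P ∪ shift (c i + c j) (shift (c i) P) := by
      rw [add_add_self_left, mem_union, mem_shift, hP, mem_shift, mem_shift, hP]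
      rintro (hD | hD)
      · exact hik (h.eq_of_add_mem hD).symm
      · refine hjk (h.eq_of_add_mem ?_).symm
        simpa only [add_comm, add_left_comm, add_assoc, add_add_self_left] using hD
    refine ⟨_, (h1.union_shift (c i + c j)).union_shift (c i + c k), ?_, fun x => ?_⟩
    · rw [(h1.union_shift _).card_union_shift (mem_union_left _ hi) hk, h1.card_union_shift hi hj,
        card_shift, hPc]
      omega
    · simp only [mem_union, mem_shift, hP, or_assoc]
      simp only [add_comm, add_left_comm, add_add_self_left]
  obtain ⟨B, hB, hBc, hBm⟩ := quad 0 1 2 (by decide) (by decide) (by decide)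
  obtain ⟨C, hC, hCc, hCm⟩ := quad 3 4 5 (by decide) (by decide) (by decide)
  have hsum : c 3 + c 4 + c 5 = c 0 + c 1 + c 2 := by
    have := h.1
    rw [Fin.sum_univ_six, ← ZModModule.sub_eq_add, sub_eq_zero] at this
    rw [← this]
    simp only [add_comm, add_left_comm, add_assoc, ZModModule.add_self, zero_add]
  rw [hsum] at hCm
  have ne : ∀ x i j, x + c i ∈ D → x + c j ∈ D → i = j := fun x i j hi hj =>
    h.eq_of_add_mem (by
      have := D.add_mem hi hj
      rwa [add_comm x (c i), add_add_add_cancel_middle] at this)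
  have nmid : ∀ x j, x + (c 0 + c 1 + c 2) ∈ D → x + c j ∉ D := fun x j h0 hj => by
    have h1 := D.add_mem h0 hj
    by_cases h2 : j = 2
    · refine absurd (h.eq_of_add_mem (i := 0) (j := 1) ?_) (by decide)
      rw [h2] at h1
      simpa only [add_comm, add_left_comm, add_assoc, add_add_self_left, ZModModule.add_self,
        add_zero] using h1
    · refine h.not_four (i := 1) (k := 2) (j := j) (by decide) (by decide) (by decide) h2 ?_
      simpa only [add_comm, add_left_comm, add_assoc, add_add_self_left] using h1
  have hBC : B ∩ C = shift (c 0 + c 1 + c 2) P := by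
    ext x
    simp only [mem_inter, hBm, hCm, mem_shift, hP]
    have n2 := nmid x
    exact ⟨fun ⟨h0, h1⟩ => by
      rcases h0 with h0 | h0 | h0 | h0
      on_goal 4 => exact h0
      all_goals
        rcases h1 with h1 | h1 | h1 | h1
        on_goal 4 => exact h1
        all_goals exact absurd (ne x _ _ h0 h1) (by decide), fun h0 => ⟨by tauto, by tauto⟩⟩
  refine ⟨B, C, hB, hC, subset_univ B, subset_univ C, hBc, hCc, by rw [hBC, card_shift, hPc], ?_⟩
  ext x
  have n2 := nmid x
  have n0 := Finset.ext_iff.1 hBC x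
  rw [mem_inter, mem_shift, hP] at n0
  have hsd : ∀ {m a b c q r : Prop}, (q ↔ a ∨ b ∨ c ∨ m) → (m → ¬a ∧ ¬b ∧ ¬c) →
      (q ∧ r ↔ m) → (q ∧ ¬r ↔ a ∨ b ∨ c) := by
    tauto
  rw [mem_symmDiff, hsd (hBm x) (fun h => ⟨n2 0 h, n2 1 h, n2 2 h⟩) n0,
    hsd (hCm x) (fun h => ⟨n2 3 h, n2 4 h, n2 5 h⟩) (and_comm.trans n0)]
  simp only [mem_cosetUnion, exists_fin_six, or_assoc]

end PairsOfFrames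

section Counting

variable {V : Type*} [AddCommGroup V] [Module (ZMod 2) V] [Fintype V]

/-- Frames modulo three-dimensional subspaces, given by their first five vectors and
a basis of the subspace. -/
noncomputable def frameData (V : Type*) [AddCommGroup V] [Module (ZMod 2) V] [Fintype V] :
    Finset ((Fin 5 → V) × (Fin 3 → V)) :=
  open Classical in univ.filter fun y => LinearIndependent (ZMod 2) y.2 ∧
    IsFrame (extend y.1) (Submodule.span (ZMod 2) (Set.range y.2))

theorem mem_frameData {y : (Fin 5 → V) × (Fin 3 → V)} :
    y ∈ frameData V ↔ LinearIndependent (ZMod 2) y.2 ∧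
      IsFrame (extend y.1) (Submodule.span (ZMod 2) (Set.range y.2)) := by
  simp [frameData]

theorem card_frameData (h : 7 ≤ Module.finrank (ZMod 2) V) :
    (frameData V).card =
      Fintype.card V * ∏ i : Fin 7, (2 ^ Module.finrank (ZMod 2) V - 2 ^ (i : ℕ)) := by
  classical
  have hw : (univ.filter fun w : Fin (4 + 3) → V => LinearIndependent (ZMod 2) w).card =
      ∏ i : Fin 7, (2 ^ Module.finrank (ZMod 2) V - 2 ^ (i : ℕ)) := by
    rw [← Fintype.card_subtype, ← Nat.card_eq_fintype_card, card_linearIndependent h, ZMod.card]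
  rw [← hw, ← card_univ, ← card_product]
  refine card_nbij' (fun y => (y.1 0, Fin.append (fun j : Fin 4 => y.1 j.succ + y.1 0) y.2))
    (fun z => (Fin.cons z.1 fun j => z.2 (Fin.castAdd 3 j) + z.1, fun k => z.2 (Fin.natAdd 4 k)))
    ?_ ?_ ?_ ?_
  · intro y hy
    rw [mem_coe, mem_frameData, isFrame_extend_iff] at hy
    rw [mem_coe, mem_product, mem_filter, linearIndependent_iff_append]
    simpa only [Fin.append_left, Fin.append_right, mem_univ, true_and] using hy
  · rintro ⟨p, w⟩ hz
    rw [mem_coe, mem_product, mem_filter, linearIndependent_iff_append] at hz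
    rw [mem_coe, mem_frameData, isFrame_extend_iff]
    simpa [add_assoc, ZModModule.add_self] using hz.2.2
  · rintro ⟨a, d⟩ -
    ext j
    · induction j using Fin.cases with
      | zero => simp
      | succ j => simp [add_assoc, ZModModule.add_self]
    · simp
  · rintro ⟨p, w⟩ -
    ext j
    · simp
    · induction j using Fin.addCases with
      | left j => simp [add_assoc, ZModModule.add_self]
      | right k => simp

variable [DecidableEq V]

theorem card_frameData_fiber {c : Fin 6 → V} {D : Submodule (ZMod 2) V} (h : IsFrame c D)
    (hD : Nat.card D = 8) :
    ((frameData V).filter fun y =>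
      cosetUnion (extend y.1) (Submodule.span (ZMod 2) (Set.range y.2)) = cosetUnion c D).card =
      720 * (8 ^ 5 * 168) := by
  classical
  have hfin : Module.finrank (ZMod 2) D = 3 := by
    have := Module.card_eq_pow_finrank (K := ZMod 2) (V := D)
    rw [← Nat.card_eq_fintype_card, hD, ZMod.card] at this
    exact (Nat.pow_right_injective le_rfl this).symm
  have hli : Fintype.card {d : Fin 3 → D // LinearIndependent (ZMod 2) d} = 168 := by
    rw [← Nat.card_eq_fintype_card, card_linearIndependent hfin.ge, hfin]
    rfl
  have hcard : (univ : Finset (Equiv.Perm (Fin 6) × (Fin 5 → D) ×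
      {d : Fin 3 → D // LinearIndependent (ZMod 2) d})).card = 720 * (8 ^ 5 * 168) := by
    rw [card_univ, Fintype.card_prod, Fintype.card_prod, Fintype.card_perm, Fintype.card_fun,
      ← Nat.card_eq_fintype_card (α := D), hD, hli, Fintype.card_fin, Fintype.card_fin]
    rfl
  have hspan : ∀ d : Fin 3 → D, LinearIndependent (ZMod 2) d →
      Submodule.span (ZMod 2) (Set.range fun k => (d k : V)) = D := fun d hd => by
    have h1 := hd.span_eq_top_of_card_eq_finrank (by simp [hfin])
    have h2 := congrArg (Submodule.map D.subtype) h1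
    rwa [Submodule.map_span, ← Set.range_comp, Submodule.map_top, Submodule.range_subtype] at h2
  have hperm : ∀ (σ : Equiv.Perm (Fin 6)) (e : Fin 5 → D) (i : Fin 6),
      extend (fun j => c (σ j.castSucc) + e j) i + c (σ i) ∈ D := by
    intro σ e i
    induction i using Fin.lastCases with
    | cast j =>
      rw [extend_castSucc, add_right_comm, ZModModule.add_self, zero_add]
      exact (e j).2
    | last =>
      have h1 := h.1
      rw [← Equiv.sum_comp σ, Fin.sum_univ_castSucc] at h1
      rw [extend_last, sum_add_distrib, add_right_comm, h1, zero_add]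
      exact D.sum_mem fun j _ => (e j).2
  rw [← hcard]
  symm
  refine card_bij (fun z _ => (fun j => c (z.1 j.castSucc) + z.2.1 j, fun k => (z.2.2.1 k : V)))
    ?_ ?_ ?_
  · rintro ⟨σ, e, d, hd⟩ -
    rw [mem_filter, mem_frameData, hspan d hd]
    exact ⟨⟨hd.map' D.subtype D.ker_subtype, h.congr (sum_extend _) (hperm σ e)⟩,
      cosetUnion_congr (hperm σ e)⟩
  · rintro ⟨σ, e, d, hd⟩ - ⟨σ', e', d', hd'⟩ - heq
    obtain ⟨h1, h2⟩ := Prod.mk.inj heq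
    have hdd : d = d' := funext fun k => Subtype.ext (congrFun h2 k)
    have h3 : ∀ i, σ i = σ' i := fun i => h.eq_of_add_mem (by
      have := D.add_mem (hperm σ e i) (hperm σ' e' i)
      simp only at h1
      rwa [h1, add_comm (extend _ i) (c (σ i)), add_add_add_cancel_middle] at this)
    obtain rfl : σ = σ' := Equiv.ext h3
    have hee : e = e' := funext fun j => Subtype.ext (add_left_cancel (congrFun h1 j))
    subst hdd hee
    rfl
  · rintro ⟨a, d⟩ hy
    rw [mem_filter, mem_frameData] at hy
    obtain ⟨⟨hd, ha⟩, he⟩ := hy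
    have hDD := h.eq_of_cosetUnion_eq ha he
    simp only at hd ha he hDD
    rw [hDD] at ha he
    obtain ⟨σ, hσ⟩ := ha.exists_perm he
    have hdD : ∀ k, d k ∈ D := fun k => hDD ▸ Submodule.subset_span (Set.mem_range_self k)
    refine ⟨⟨σ, fun j => ⟨a j + c (σ j.castSucc), ?_⟩, fun k => ⟨d k, hdD k⟩, ?_⟩, mem_univ _, ?_⟩
    · simpa using hσ j.castSucc
    · exact LinearIndependent.of_comp D.subtype hd
    · ext j
      · simp only [add_comm (a j), add_add_self_left]
      · rfl

/-- The number of flat pairs, by double counting of the frames defining them. -/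
theorem card_isFlatPair (hV : Fintype.card V = 512) :
    (open Classical in univ.filter fun S : Finset V => IsFlatPair 32 univ S).card =
      919315326720 := by
  classical
  have hfin : Module.finrank (ZMod 2) V = 9 := by
    have := Module.card_eq_pow_finrank (K := ZMod 2) (V := V)
    rw [hV, ZMod.card] at this
    exact (Nat.pow_right_injective le_rfl (this.symm.trans (by norm_num : 512 = 2 ^ 9)))
  have hmaps : Set.MapsTo (fun y : (Fin 5 → V) × (Fin 3 → V) =>
      cosetUnion (extend y.1) (Submodule.span (ZMod 2) (Set.range y.2))) (frameData V)
      (univ.filter fun S : Finset V => IsFlatPair 32 univ S : Finset (Finset V)) := by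
    intro y hy
    obtain ⟨hd, ha⟩ := mem_frameData.1 hy
    rw [mem_coe, mem_filter]
    refine ⟨mem_univ _, ha.isFlatPair (d := 8) ?_⟩
    rw [Nat.card_eq_fintype_card, Module.card_eq_pow_finrank (K := ZMod 2),
      finrank_span_eq_card hd, ZMod.card, Fintype.card_fin]
    norm_num
  have hsum := card_eq_sum_card_fiberwise hmaps
  rw [sum_const_nat (m := 720 * (8 ^ 5 * 168)) fun S hS => ?_, card_frameData (by omega), hV,
    hfin] at hsum
  · simp only [Fin.prod_univ_seven] at hsum
    norm_num at hsum
    omega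
  · obtain ⟨c, D, hD, hc, rfl⟩ :=
      IsFlatPair.exists_frame (d := 8) (by norm_num) (mem_filter.1 hS).2
    exact card_frameData_fiber hc hD

end Counting

section Codewords

theorem IsFlatPair.degLT_indicator {V : Type*} [AddCommGroup V] [Module (ZMod 2) V]
    [DecidableEq V] [Fintype V] {s d : ℕ} {W S : Finset V} (h : IsFlatPair d W S)
    (hs : Fintype.card V < d * 2 ^ s) : DegLT s univ fun x => if x ∈ S then 1 else 0 := by
  obtain ⟨B, C, hB, hC, -, -, hBd, hCd, -, rfl⟩ := h
  convert (hB.degLT_indicator (hBd ▸ hs)).add (hC.degLT_indicator (hCd ▸ hs)) using 2 with x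
  by_cases h1 : x ∈ B <;> by_cases h2 : x ∈ C <;>
    simp [mem_symmDiff, h1, h2, ZModModule.add_self]

/-- Codewords of weight at most `3 / 2` times the minimum weight. -/
theorem support_of_mem_RM {r k m : ℕ} (hm : r + k = m) {f : BF m} (hf : f ∈ RM r m)
    (h0 : 0 < wt f) (hle : 2 * wt f ≤ 3 * 2 ^ k) :
    wt f = 2 ^ k ∨ IsFlatPair (2 ^ k) univ (univ.filter (f · = 1)) :=
  (DegLT.support_classification hm ⟨univ_nonempty, fun _ _ _ _ _ _ => mem_univ _⟩ (by simp)
    (mem_RM_iff.1 hf) (card_pos.1 h0) hle).imp_left And.right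

/-- There are no codewords of weight strictly between `2 ^ k` and `3 / 2 * 2 ^ k`. -/
theorem not_exists_wt_between {r k m d w : ℕ} (hm : r + k = m) (hd : d = 2 ^ k)
    (hw : 2 * w = 3 * 2 ^ k) : ¬ ∃ f ∈ RM r m, d < wt f ∧ wt f < w := by
  rintro ⟨f, hf, h1, h2⟩
  rcases support_of_mem_RM hm hf (by omega) (by omega) with h | h
  · omega
  · have : 2 * wt f = 3 * 2 ^ k := h.two_mul_card
    omega

/-- The codewords of weight `3 / 2 * 2 ^ k` are the indicator functions of flat pairs. -/
theorem card_filter_wt_eq {r k m w : ℕ} (hm : r + k = m) (hw : 2 * w = 3 * 2 ^ k) :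
    ((RM r m).filter (fun f => wt f = w)).card =
      (open Classical in
        univ.filter fun S : Finset (Fin m → ZMod 2) => IsFlatPair (2 ^ k) univ S).card := by
  classical
  have hpos : 0 < 2 ^ k := by positivity
  refine card_nbij' (fun f => univ.filter (f · = 1)) (fun S x => if x ∈ S then 1 else 0)
    ?_ ?_ ?_ ?_
  · intro f hf
    obtain ⟨hf, hfw⟩ := mem_filter.1 hf
    rw [mem_coe, mem_filter]
    exact ⟨mem_univ _, (support_of_mem_RM hm hf (by omega) (by omega)).resolve_left (by omega)⟩
  · intro S hS
    have h := (mem_filter.1 hS).2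
    have h2 := h.two_mul_card
    rw [mem_coe, mem_filter, mem_RM_iff]
    refine ⟨h.degLT_indicator ?_, ?_⟩
    · rw [Fintype.card_fun, ZMod.card, Fintype.card_fin, ← pow_add]
      exact Nat.pow_lt_pow_right (by norm_num) (by omega)
    · simp only [wt, ite_eq_left_iff, zero_ne_one, imp_false, not_not, filter_univ_mem]
      omega
  · intro f _
    ext x
    rcases eq_zero_or_one (f x) with h | h <;> simp [h]
  · intro S _
    simp

end Codewords

/-- In `R(4,9)`, there is no codeword of weight strictly between `32` and `48`,
and there are exactly `919315326720` codewords of weight `48`. -/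
theorem statement11 :
    (¬ ∃ f ∈ RM 4 9, 32 < wt f ∧ wt f < 48) ∧
    ((RM 4 9).filter (fun f => wt f = 48)).card = 919315326720 := by
  exact ⟨not_exists_wt_between (k := 5) rfl rfl rfl,
    (card_filter_wt_eq (k := 5) rfl rfl).trans (card_isFlatPair (by simp))⟩
end
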